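/- arXiv:2206.09129 — 10 statements merged into one kernel-verified Lean document; each statement's English description precedes it below -/
import Mathlib

section
/- Let n ≥ 2. There exists a surjective monoid homomorphism from the Kiselman monoid Kis_n onto the stylic monoid Styl_n that sends the i-th generator of Kis_n to the i-th generator of Styl_n for each i = 1,…,n. -/
/-- Defining relations of the stylic monoid `Styl_n` (Abram–Reutenauer presentation):
`a_i² = a_i`; `a_j a_i a_k = a_j a_k a_i` and `a_i a_k a_j = a_k a_i a_j` for `i < j < k`;
`a_j a_i a_i = a_i a_j a_i` and `a_j a_j a_i = a_j a_i a_j` for `i < j`. -/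
def stylRel (n : ℕ) : FreeMonoid (Fin n) → FreeMonoid (Fin n) → Prop := fun u v =>
  (∃ i : Fin n, u = .of i * .of i ∧ v = .of i) ∨
  (∃ i j k : Fin n, i < j ∧ j < k ∧ u = .of j * .of i * .of k ∧ v = .of j * .of k * .of i) ∨
  (∃ i j k : Fin n, i < j ∧ j < k ∧ u = .of i * .of k * .of j ∧ v = .of k * .of i * .of j) ∨
  (∃ i j : Fin n, i < j ∧ u = .of j * .of i * .of i ∧ v = .of i * .of j * .of i) ∨
  (∃ i j : Fin n, i < j ∧ u = .of j * .of j * .of i ∧ v = .of j * .of i * .of j)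

/-- The stylic monoid on `n` generators. -/
abbrev Styl (n : ℕ) := PresentedMonoid (stylRel n)

/-- The `i`-th generator of the stylic monoid. -/
def stylGen (n : ℕ) (i : Fin n) : Styl n := PresentedMonoid.of (stylRel n) i

/-- Defining relations of the Kiselman monoid `Kis_n`:
`a_i² = a_i`; `a_i a_j a_i = a_j a_i` and `a_j a_i a_j = a_j a_i` for `i < j`. -/
def kisRel (n : ℕ) : FreeMonoid (Fin n) → FreeMonoid (Fin n) → Prop := fun u v =>
  (∃ i : Fin n, u = .of i * .of i ∧ v = .of i) ∨
  (∃ i j : Fin n, i < j ∧ u = .of i * .of j * .of i ∧ v = .of j * .of i) ∨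
  (∃ i j : Fin n, i < j ∧ u = .of j * .of i * .of j ∧ v = .of j * .of i)

/-- The Kiselman monoid on `n` generators. -/
abbrev Kis (n : ℕ) := PresentedMonoid (kisRel n)

/-- The `i`-th generator of the Kiselman monoid. -/
def kisGen (n : ℕ) (i : Fin n) : Kis n := PresentedMonoid.of (kisRel n) i

theorem stylGen_mk_rel (n : ℕ) {u v : FreeMonoid (Fin n)} (h : stylRel n u v) :
    FreeMonoid.lift (stylGen n) u = FreeMonoid.lift (stylGen n) v := by
  have key : FreeMonoid.lift (stylGen n) = PresentedMonoid.mk (stylRel n) := by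
    ext i
    simp [stylGen, PresentedMonoid.of]
  rw [key]
  exact PresentedMonoid.mk_eq_mk_of_rel h

/-- For `n ≥ 2`, there is a surjective monoid homomorphism `Kis_n → Styl_n`
sending the `i`-th generator to the `i`-th generator. -/
theorem kiselman_maps_onto_stylic (n : ℕ) (hn : 2 ≤ n) :
    ∃ f : Kis n →* Styl n, Function.Surjective f ∧ ∀ i : Fin n, f (kisGen n i) = stylGen n i := by
  have sq : ∀ i, stylGen n i * stylGen n i = stylGen n i := fun i => by
    simpa using stylGen_mk_rel n (Or.inl ⟨i, rfl, rfl⟩)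
  have h1 : ∀ i j, i < j →
      stylGen n j * stylGen n i * stylGen n i = stylGen n i * stylGen n j * stylGen n i :=
    fun i j h => by
      simpa using stylGen_mk_rel n (Or.inr (Or.inr (Or.inr (Or.inl ⟨i, j, h, rfl, rfl⟩))))
  have h2 : ∀ i j, i < j →
      stylGen n j * stylGen n j * stylGen n i = stylGen n j * stylGen n i * stylGen n j :=
    fun i j h => by
      simpa using stylGen_mk_rel n (Or.inr (Or.inr (Or.inr (Or.inr ⟨i, j, h, rfl, rfl⟩))))
  have hk : ∀ u v, kisRel n u v →
      FreeMonoid.lift (stylGen n) u = FreeMonoid.lift (stylGen n) v := by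
    rintro u v (⟨i, rfl, rfl⟩ | ⟨i, j, h, rfl, rfl⟩ | ⟨i, j, h, rfl, rfl⟩)
    · simpa using sq i
    · simp only [map_mul, FreeMonoid.lift_eval_of]
      rw [← h1 i j h, mul_assoc, sq]
    · simp only [map_mul, FreeMonoid.lift_eval_of]
      rw [← h2 i j h, sq]
  have hgen : ∀ i, PresentedMonoid.lift (stylGen n) hk (kisGen n i) = stylGen n i := fun i => by
    simp [kisGen]
  refine ⟨PresentedMonoid.lift (stylGen n) hk, ?_, hgen⟩
  rw [← MonoidHom.mrange_eq_top, ← top_le_iff, ← PresentedMonoid.closure_range_of (stylRel n),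
    Submonoid.closure_le]
  rintro _ ⟨i, rfl⟩
  exact ⟨kisGen n i, hgen i⟩
end

section
/- Let n ≥ 2. There exists a surjective monoid homomorphism from the stylic monoid Styl_n onto the Catalan monoid Cat_n that sends the i-th generator of Styl_n to the i-th generator of Cat_n for each i = 1,…,n. -/
/-- Defining relations of the Catalan monoid `Cat_n` (Solomon's presentation):
`a_i² = a_i`; `a_i a_k = a_k a_i` if `|i − k| ≥ 2`;
`a_i a_{i+1} a_i = a_{i+1} a_i` and `a_{i+1} a_i a_{i+1} = a_{i+1} a_i`. -/
def catRel (n : ℕ) : FreeMonoid (Fin n) → FreeMonoid (Fin n) → Prop := fun u v =>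
  (∃ i : Fin n, u = .of i * .of i ∧ v = .of i) ∨
  (∃ i k : Fin n, ((i : ℕ) + 2 ≤ (k : ℕ) ∨ (k : ℕ) + 2 ≤ (i : ℕ)) ∧
    u = .of i * .of k ∧ v = .of k * .of i) ∨
  (∃ i j : Fin n, (i : ℕ) + 1 = (j : ℕ) ∧ u = .of i * .of j * .of i ∧ v = .of j * .of i) ∨
  (∃ i j : Fin n, (i : ℕ) + 1 = (j : ℕ) ∧ u = .of j * .of i * .of j ∧ v = .of j * .of i)

/-- The Catalan monoid on `n` generators. -/
abbrev Cat (n : ℕ) := PresentedMonoid (catRel n)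

/-- The `i`-th generator of the Catalan monoid. -/
def catGen (n : ℕ) (i : Fin n) : Cat n := PresentedMonoid.of (catRel n) i

theorem catGen_idem (n : ℕ) (i : Fin n) : catGen n i * catGen n i = catGen n i :=
  Quotient.sound (ConGen.Rel.of _ _ (Or.inl ⟨i, rfl, rfl⟩))

theorem catGen_comm (n : ℕ) (i k : Fin n) (h : (i : ℕ) + 2 ≤ (k : ℕ)) :
    catGen n i * catGen n k = catGen n k * catGen n i :=
  Quotient.sound (ConGen.Rel.of _ _ (Or.inr (Or.inl ⟨i, k, Or.inl h, rfl, rfl⟩)))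

theorem catGen_left (n : ℕ) (i j : Fin n) (h : i < j) :
    catGen n i * catGen n j * catGen n i = catGen n j * catGen n i := by
  by_cases h1 : (i : ℕ) + 1 = (j : ℕ)
  · exact Quotient.sound (ConGen.Rel.of _ _ (Or.inr (Or.inr (Or.inl ⟨i, j, h1, rfl, rfl⟩))))
  · have h2 : (i : ℕ) + 2 ≤ (j : ℕ) := by
      have : (i : ℕ) < (j : ℕ) := h
      omega
    rw [catGen_comm n i j h2, mul_assoc, catGen_idem]

theorem catGen_right (n : ℕ) (i j : Fin n) (h : i < j) :
    catGen n j * catGen n i * catGen n j = catGen n j * catGen n i := by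
  by_cases h1 : (i : ℕ) + 1 = (j : ℕ)
  · exact Quotient.sound (ConGen.Rel.of _ _ (Or.inr (Or.inr (Or.inr ⟨i, j, h1, rfl, rfl⟩))))
  · have h2 : (i : ℕ) + 2 ≤ (j : ℕ) := by
      have : (i : ℕ) < (j : ℕ) := h
      omega
    rw [mul_assoc, catGen_comm n i j h2, ← mul_assoc, catGen_idem]

theorem catGen_stylRel (n : ℕ) (u v : FreeMonoid (Fin n)) (h : stylRel n u v) :
    FreeMonoid.lift (catGen n) u = FreeMonoid.lift (catGen n) v := by
  have far : ∀ i j k : Fin n, i < j → j < k → (i : ℕ) + 2 ≤ (k : ℕ) := by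
    intro i j k h1 h2
    have h3 : (i : ℕ) < (j : ℕ) := h1
    have h4 : (j : ℕ) < (k : ℕ) := h2
    omega
  rcases h with ⟨i, rfl, rfl⟩ | ⟨i, j, k, h1, h2, rfl, rfl⟩ | ⟨i, j, k, h1, h2, rfl, rfl⟩ |
    ⟨i, j, h1, rfl, rfl⟩ | ⟨i, j, h1, rfl, rfl⟩ <;> simp only [map_mul, FreeMonoid.lift_eval_of]
  · exact catGen_idem n i
  · rw [mul_assoc, catGen_comm n i k (far i j k h1 h2), mul_assoc]
  · rw [catGen_comm n i k (far i j k h1 h2)]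
  · rw [catGen_left n i j h1, mul_assoc, catGen_idem]
  · rw [catGen_right n i j h1, catGen_idem]

/-- For `n ≥ 2`, there is a surjective monoid homomorphism `Styl_n → Cat_n`
sending the `i`-th generator to the `i`-th generator. -/
theorem stylic_maps_onto_catalan (n : ℕ) (hn : 2 ≤ n) :
    ∃ f : Styl n →* Cat n, Function.Surjective f ∧ ∀ i : Fin n, f (stylGen n i) = catGen n i := by
  have hgen : ∀ i : Fin n, PresentedMonoid.lift (catGen n) (catGen_stylRel n) (stylGen n i)
      = catGen n i := fun i => rfl
  refine ⟨PresentedMonoid.lift (catGen n) (catGen_stylRel n), ?_, hgen⟩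
  rw [← MonoidHom.mrange_eq_top, eq_top_iff, ← PresentedMonoid.closure_range_of (catRel n),
    Submonoid.closure_le]
  rintro _ ⟨i, rfl⟩
  exact ⟨stylGen n i, hgen i⟩
end

section
/- Let n ≥ 2 and let X be an alphabet. Every monoid identity w = w' over X that holds in the Kiselman monoid Kis_n also holds in the stylic monoid Styl_n. -/
lemma styl_eq_of_rel {n : ℕ} {u v : FreeMonoid (Fin n)} (h : stylRel n u v) :
    PresentedMonoid.mk (stylRel n) u = PresentedMonoid.mk (stylRel n) v :=
  Quotient.sound (ConGen.Rel.of _ _ h)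

lemma stylGen_idem (n : ℕ) (i : Fin n) : stylGen n i * stylGen n i = stylGen n i :=
  styl_eq_of_rel (n := n) (Or.inl ⟨i, rfl, rfl⟩)

lemma stylGen_iji (n : ℕ) (i j : Fin n) (h : i < j) :
    stylGen n i * stylGen n j * stylGen n i = stylGen n j * stylGen n i := by
  have h1 : stylGen n j * stylGen n i * stylGen n i = stylGen n i * stylGen n j * stylGen n i :=
    styl_eq_of_rel (n := n) (Or.inr (Or.inr (Or.inr (Or.inl ⟨i, j, h, rfl, rfl⟩))))
  rw [← h1, mul_assoc, stylGen_idem]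

lemma stylGen_jij (n : ℕ) (i j : Fin n) (h : i < j) :
    stylGen n j * stylGen n i * stylGen n j = stylGen n j * stylGen n i := by
  have h1 : stylGen n j * stylGen n j * stylGen n i = stylGen n j * stylGen n i * stylGen n j :=
    styl_eq_of_rel (n := n) (Or.inr (Or.inr (Or.inr (Or.inr ⟨i, j, h, rfl, rfl⟩))))
  rw [← h1, stylGen_idem]

/-- The stylic monoid is a quotient of the Kiselman monoid. -/
def kisToStyl (n : ℕ) : Kis n →* Styl n :=
  PresentedMonoid.lift (stylGen n) (by
    rintro a b (⟨i, rfl, rfl⟩ | ⟨i, j, h, rfl, rfl⟩ | ⟨i, j, h, rfl, rfl⟩)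
    · simpa using stylGen_idem n i
    · simpa using stylGen_iji n i j h
    · simpa using stylGen_jij n i j h)

lemma kisToStyl_mk (n : ℕ) (u : FreeMonoid (Fin n)) :
    kisToStyl n (PresentedMonoid.mk (kisRel n) u) = PresentedMonoid.mk (stylRel n) u := by
  have : (kisToStyl n).comp (PresentedMonoid.mk (kisRel n)) = PresentedMonoid.mk (stylRel n) := by
    apply FreeMonoid.hom_eq
    intro i
    rfl
  exact DFunLike.congr_fun this u

lemma kisToStyl_surjective (n : ℕ) : Function.Surjective (kisToStyl n) := by
  intro y
  obtain ⟨u, rfl⟩ : ∃ u, PresentedMonoid.mk (stylRel n) u = y := Quotient.exists_rep y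
  exact ⟨_, kisToStyl_mk n u⟩

/-- For `n ≥ 2`, every monoid identity `w = w'` holding in the Kiselman monoid `Kis_n`
also holds in the stylic monoid `Styl_n`. -/
theorem identity_of_kiselman_holds_in_stylic (n : ℕ) (hn : 2 ≤ n) (X : Type*)
    (w w' : FreeMonoid X) (h : ∀ φ : FreeMonoid X →* Kis n, φ w = φ w') :
    ∀ φ : FreeMonoid X →* Styl n, φ w = φ w' := by
  intro φ
  choose g hg using kisToStyl_surjective n
  have key : (kisToStyl n).comp (FreeMonoid.lift fun x => g (φ (FreeMonoid.of x))) = φ := by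
    apply FreeMonoid.hom_eq
    intro x
    simp [hg]
  rw [← key]
  simp only [MonoidHom.comp_apply]
  rw [h]
end

section
/- Let n ≥ 2 and let X be an alphabet. For any two words w, w' in the free monoid X*, the identity w = w' holds in the Catalan monoid Cat_n if and only if it holds in the stylic monoid Styl_n, if and only if it holds in the Kiselman monoid Kis_n; that is, the three monoids Cat_n, Styl_n, Kis_n satisfy exactly the same identities. -/
namespace CSK

/-- Same scattered subwords of length at most `n`. -/
def SimEq {α : Type*} (n : ℕ) (f g : List α) : Prop :=
  ∀ s : List α, s.length ≤ n → (s.Sublist f ↔ s.Sublist g)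

/-- The Kiselman relations for a family in a monoid. -/
structure KisFam {M : Type*} [Monoid M] {n : ℕ} (g : Fin n → M) : Prop where
  idem : ∀ i, g i * g i = g i
  left : ∀ i j, i < j → g i * g j * g i = g j * g i
  right : ∀ i j, i < j → g j * g i * g j = g j * g i

/-- Evaluation of a word. -/
def ev {M : Type*} [Monoid M] {ι : Type*} (g : ι → M) (l : List ι) : M := (l.map g).prod

theorem ev_append {M : Type*} [Monoid M] {ι : Type*} (g : ι → M) (l k : List ι) :
    ev g (l ++ k) = ev g l * ev g k := by simp [ev]

theorem ev_cons {M : Type*} [Monoid M] {ι : Type*} (g : ι → M) (a : ι) (k : List ι) :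
    ev g (a :: k) = g a * ev g k := by simp [ev]

theorem ev_single {M : Type*} [Monoid M] {ι : Type*} (g : ι → M) (a : ι) :
    ev g [a] = g a := by simp [ev]

theorem ev_rev {M : Type*} [Monoid M] {n : ℕ} (g : Fin n → M) (l : List (Fin n)) :
    ev (fun i => MulOpposite.op (g (Fin.rev i))) (l.map Fin.rev).reverse
      = MulOpposite.op (ev g l) := by
  induction l with
  | nil => simp [ev]
  | cons a l ih =>
    rw [List.map_cons, List.reverse_cons, ev_append, ih, ev_single, ev_cons]
    simp

theorem absorb_lt {M : Type*} [Monoid M] {n : ℕ} {g : Fin n → M} (hg : KisFam g) (a : Fin n)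
    (z : List (Fin n)) (hz : ∀ b ∈ z, b < a) : g a * ev g z * g a = g a * ev g z := by
  induction z with
  | nil => simp [ev, hg.idem]
  | cons b z ih =>
    have hb := hg.right b a (hz b (by simp))
    have ih' := ih (fun c hc => hz c (by simp [hc]))
    rw [ev_cons]
    calc g a * (g b * ev g z) * g a = (g a * g b) * ev g z * g a := by simp only [mul_assoc]
      _ = (g a * g b * g a) * ev g z * g a := by rw [hb]
      _ = g a * g b * (g a * ev g z * g a) := by simp only [mul_assoc]
      _ = (g a * g b * g a) * ev g z := by rw [ih']; simp only [mul_assoc]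
      _ = g a * (g b * ev g z) := by rw [hb]; simp only [mul_assoc]

theorem sub_before_last {α : Type*} {s y z : List α} {a : α} (hz : a ∉ z)
    (h : (s ++ [a]).Sublist (y ++ a :: z)) : s.Sublist y := by
  rw [← List.reverse_sublist] at h ⊢
  simp only [List.reverse_append, List.reverse_cons, List.reverse_nil, List.nil_append,
    List.append_assoc, List.singleton_append] at h
  have hz' : a ∉ z.reverse := by simpa using hz
  generalize z.reverse = zz at h hz'
  induction zz with
  | nil => exact (List.cons_sublist_cons (a := a)).1 h
  | cons c zz ih =>
    simp only [List.mem_cons, not_or] at hz'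
    rw [List.cons_append] at h
    exact ih (h.of_cons_of_ne hz'.1) hz'.2

theorem absorb_right {M : Type*} [Monoid M] {n : ℕ} {g : Fin n → M} (hg : KisFam g) :
    ∀ (m : ℕ) (a : Fin n) (u : List (Fin n)), n - (a : ℕ) ≤ m →
      (∀ s : List (Fin n), s.length < m → s.Sublist u → (s ++ [a]).Sublist u) →
      ev g u * g a = ev g u := by
  intro m
  induction m with
  | zero => intro a u h; have := a.2; omega
  | succ m ih =>
    intro a u hm hD
    have ha : a ∈ u := by
      have := hD [] (by simp) (by simp)
      simpa using this
    obtain ⟨y, z, hu, hz⟩ : ∃ y z, u = y ++ a :: z ∧ a ∉ z := by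
      have h1 : a ∈ u.reverse := by simpa using ha
      obtain ⟨p, q, hp, hq⟩ := List.eq_append_cons_of_mem h1
      exact ⟨q.reverse, p.reverse, by
        rw [← List.reverse_reverse u, hp]; simp, by simpa using hq⟩
    have key : ∀ z1 z2, z = z1 ++ z2 →
        ∃ z', (∀ b ∈ z', b < a) ∧ ev g (y ++ a :: z1) = ev g y * (g a * ev g z') := by
      intro z1
      induction z1 using List.reverseRecOn with
      | nil => intro z2 _; exact ⟨[], by simp, by simp [ev]⟩
      | append_singleton z1 b ihz =>
        intro z2 hz2
        obtain ⟨z', hz', he⟩ := ihz (b :: z2) (by simp [hz2])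
        have hba : b ≠ a := by
          rintro rfl
          exact hz (by simp [hz2])
        have hsplit : ev g (y ++ a :: (z1 ++ [b])) = ev g (y ++ a :: z1) * g b := by
          rw [← ev_single g b, ← ev_append]; simp
        rcases lt_or_gt_of_ne hba with hlt | hgt
        · refine ⟨z' ++ [b], ?_, ?_⟩
          · intro c hc
            rcases List.mem_append.1 hc with hc | hc
            · exact hz' c hc
            · rw [List.mem_singleton.1 hc]; exact hlt
          · rw [hsplit, he, ev_append, ev_single]; simp only [mul_assoc]
        · refine ⟨z', hz', ?_⟩
          rw [hsplit, ih b (y ++ a :: z1), he]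
          · have : (a : ℕ) < b := hgt
            omega
          · intro s hs hsub
            have h1 : (s ++ [b]).Sublist u := by
              have : ((y ++ a :: z1) ++ [b]).Sublist u := by
                rw [hu, hz2]; simp
              exact (hsub.append (List.Sublist.refl [b])).trans this
            have h2 := hD (s ++ [b]) (by simp; omega) h1
            rw [hu] at h2
            exact (sub_before_last hz h2).trans (List.sublist_append_left _ _)
    obtain ⟨z', hz', he⟩ := key z [] (by simp)
    rw [hu, he, mul_assoc, absorb_lt hg a z' hz']

theorem KisFam.op {M : Type*} [Monoid M] {n : ℕ} {g : Fin n → M} (hg : KisFam g) :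
    KisFam (fun i => MulOpposite.op (g (Fin.rev i))) := by
  refine ⟨fun i => ?_, fun i j h => ?_, fun i j h => ?_⟩
  · simp [← MulOpposite.op_mul, hg.idem]
  · have := hg.right _ _ (Fin.rev_lt_rev.2 h)
    simp only [← MulOpposite.op_mul, ← mul_assoc, this]
  · have := hg.left _ _ (Fin.rev_lt_rev.2 h)
    simp only [← MulOpposite.op_mul, ← mul_assoc, this]

theorem absorb_left {M : Type*} [Monoid M] {n : ℕ} {g : Fin n → M} (hg : KisFam g)
    (a : Fin n) (v : List (Fin n))
    (hD : ∀ s : List (Fin n), s.length < (a : ℕ) + 1 → s.Sublist v → (a :: s).Sublist v) :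
    g a * ev g v = ev g v := by
  have := absorb_right hg.op ((a : ℕ) + 1) (Fin.rev a) (v.map Fin.rev).reverse
    (by rw [Fin.val_rev]; have := a.2; omega)
    (by
      intro s hs hsub
      have h1 : (s.reverse.map Fin.rev).Sublist v := by
        have h2 := (hsub.reverse).map Fin.rev
        simpa [List.map_map, Function.comp_def] using h2
      have h3 := hD _ (by simpa using hs) h1
      have h4 := (h3.map Fin.rev).reverse
      simpa [List.map_map, Function.comp_def] using h4)
  rw [ev_rev] at this
  simp only [Fin.rev_rev, ← MulOpposite.op_mul] at this
  exact MulOpposite.op_injective this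

theorem sub_split {α : Type*} {s t u v : List α} {a : α}
    (h : (s ++ a :: t).Sublist (u ++ v)) : (s ++ [a]).Sublist u ∨ (a :: t).Sublist v := by
  obtain ⟨l1, l2, h0, h1, h2⟩ := List.sublist_append_iff.1 h
  rcases List.append_eq_append_iff.1 h0 with ⟨c, hc1, hc2⟩ | ⟨c, hc1, hc2⟩
  · cases c with
    | nil => right; simp at hc2; rw [hc2]; exact h2
    | cons d c =>
      left
      simp only [List.cons_append, List.cons.injEq] at hc2
      rw [hc1, ← hc2.1] at h1
      refine List.Sublist.trans ?_ h1
      simp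
  · right
    rw [hc2] at h2
    exact (List.sublist_append_right _ _).trans h2

theorem insert_eq {M : Type*} [Monoid M] {n : ℕ} {g : Fin n → M} (hg : KisFam g)
    (u v : List (Fin n)) (a : Fin n) (h : SimEq n (u ++ v) (u ++ a :: v)) :
    ev g (u ++ v) = ev g (u ++ a :: v) := by
  rw [ev_append, ev_append, ev_cons]
  by_cases h1 : ∀ s : List (Fin n), s.length < n - (a : ℕ) → s.Sublist u → (s ++ [a]).Sublist u
  · rw [← mul_assoc, absorb_right hg _ a u le_rfl h1]
  by_cases h2 : ∀ s : List (Fin n), s.length < (a : ℕ) + 1 → s.Sublist v → (a :: s).Sublist v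
  · rw [absorb_left hg a v h2]
  exfalso
  push Not at h1 h2
  obtain ⟨s, hs, hs1, hs2⟩ := h1
  obtain ⟨t, ht, ht1, ht2⟩ := h2
  have h3 := (h (s ++ a :: t) (by simp; omega)).2 (hs1.append (ht1.cons_cons a))
  rcases sub_split h3 with h4 | h4
  · exact hs2 h4
  · exact ht2 h4

/-- Failing to insert gives a witness. -/
theorem not_insert {α : Type*} {n : ℕ} {u v : List α} {b : α}
    (h : ¬ SimEq n (u ++ v) (u ++ b :: v)) :
    ∃ s t : List α, s.length + t.length + 1 ≤ n ∧ s.Sublist u ∧ t.Sublist v ∧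
      ¬ (s ++ b :: t).Sublist (u ++ v) := by
  by_contra hc
  push Not at hc
  apply h
  intro r hr
  refine ⟨fun h1 => h1.trans (List.Sublist.append (List.Sublist.refl _)
    (List.sublist_cons_self _ _)), fun h1 => ?_⟩
  obtain ⟨l1, l2, rfl, h2, h3⟩ := List.sublist_append_iff.1 h1
  cases h3 with
  | cons _ h3 => exact h2.append h3
  | cons_cons _ h3 =>
    rename_i l2
    exact hc l1 l2 (by simp at hr; omega) h2 h3

theorem aux {α : Type*} {n : ℕ} {u f g : List α} {a b : α} (hab : a ≠ b)
    (h : SimEq n (u ++ a :: f) (u ++ b :: g)) {u1 v1 u2 v2 : List α}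
    (hlen : u1.length + v2.length + 1 ≤ n)
    (hlen2 : u2.length + v2.length + 1 ≤ n)
    (h1u : u1.Sublist u) (h1v : v1.Sublist (a :: f)) (h1 : ¬ (u1 ++ b :: v1).Sublist (u ++ a :: f))
    (h2u : u2.Sublist u) (h2v : v2.Sublist (b :: g)) (h2 : ¬ (u2 ++ a :: v2).Sublist (u ++ b :: g)) :
    False := by
  have h1b : ¬ (u1 ++ [b]).Sublist u := by
    intro hh
    apply h1
    have := hh.append h1v
    simpa using this
  have fin : v2.Sublist f := by
    have gen : ∀ v, v.length ≤ v2.length → v.Sublist g → (b :: v).Sublist f := by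
      intro v hv hvg
      have h3 : (u1 ++ b :: v).Sublist (u ++ b :: g) := h1u.append (hvg.cons_cons b)
      have h4 := (h _ (by simp; omega)).2 h3
      rcases sub_split h4 with h5 | h5
      · exact absurd h5 h1b
      · exact h5.of_cons_of_ne (Ne.symm hab)
    cases h2v with
    | cons _ h3 => exact (List.sublist_cons_self _ _).trans (gen v2 le_rfl h3)
    | cons_cons _ h3 => exact gen _ (by simp) h3
  exact h2 ((h _ (by simp; omega)).1 (h2u.append (fin.cons_cons a)))

theorem SimEq.symm {α : Type*} {n : ℕ} {f g : List α} (h : SimEq n f g) : SimEq n g f :=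
  fun s hs => (h s hs).symm

theorem SimEq.trans {α : Type*} {n : ℕ} {f g k : List α} (h : SimEq n f g) (h' : SimEq n g k) :
    SimEq n f k :=
  fun s hs => (h s hs).trans (h' s hs)

theorem insert_or {α : Type*} {n : ℕ} {u f g : List α} {a b : α} (hab : a ≠ b)
    (h : SimEq n (u ++ a :: f) (u ++ b :: g)) :
    SimEq n (u ++ a :: f) (u ++ b :: a :: f) ∨ SimEq n (u ++ b :: g) (u ++ a :: b :: g) := by
  by_contra hc
  rw [not_or] at hc
  obtain ⟨u1, v1, hl1, h1u, h1v, h1⟩ := not_insert hc.1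
  obtain ⟨u2, v2, hl2, h2u, h2v, h2⟩ := not_insert hc.2
  rcases le_total v2.length v1.length with hl | hl
  · exact aux hab h (by omega) (by omega) h1u h1v h1 h2u h2v h2
  · exact aux (Ne.symm hab) h.symm (by omega) (by omega) h2u h2v h2 h1u h1v h1

theorem nil_insert {α : Type*} {n : ℕ} {u g : List α} {b : α}
    (h : SimEq n (u ++ []) (u ++ b :: g)) : SimEq n (u ++ []) (u ++ b :: []) := by
  intro s hs
  refine ⟨fun h1 => h1.trans (by simp), fun h1 => (h s hs).2 (h1.trans ?_)⟩
  exact List.Sublist.append (List.Sublist.refl _) (by simp)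

theorem main_kis {M : Type*} [Monoid M] {n : ℕ} {g : Fin n → M} (hg : KisFam g) :
    ∀ (N : ℕ) (u p q : List (Fin n)), p.length + q.length = N →
      SimEq n (u ++ p) (u ++ q) → ev g (u ++ p) = ev g (u ++ q) := by
  intro N
  induction N using Nat.strong_induction_on with
  | _ N ih =>
    -- inserting a letter into the left word
    have step : ∀ (u p q : List (Fin n)) (b : Fin n), p.length + (b :: q).length = N →
        SimEq n (u ++ p) (u ++ b :: q) → SimEq n (u ++ p) (u ++ b :: p) →
        ev g (u ++ p) = ev g (u ++ b :: q) := by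
      intro u p q b hl h hi
      rw [insert_eq hg u p b hi]
      have := ih (p.length + q.length) (by simp at hl; omega) (u ++ [b]) p q rfl
        (by simpa using hi.symm.trans h)
      simpa using this
    intro u p q hl h
    cases p with
    | nil =>
      cases q with
      | nil => rfl
      | cons b q => exact step u [] q b hl h (nil_insert h)
    | cons a p =>
      cases q with
      | nil => exact (step u [] p a (by simpa using hl) h.symm (nil_insert h.symm)).symm
      | cons b q =>
        by_cases hab : a = b
        · subst hab
          have := ih (p.length + q.length) (by simp at hl; omega) (u ++ [a]) p q rfl
            (by simpa using h)
          simpa using this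
        · rcases insert_or hab h with hi | hi
          · exact step u (a :: p) q b hl h hi
          · exact (step u (b :: q) p a (by simp at hl ⊢; omega) h.symm hi).symm

theorem sub_flatMap {X α : Type*} (L : X → List α) (w : List X) :
    ∀ s : List α, s.Sublist (w.flatMap L) →
      ∃ t : List X, t.Sublist w ∧ t.length ≤ s.length ∧ s.Sublist (t.flatMap L) := by
  induction w with
  | nil => intro s hs; exact ⟨[], by simp, by simp, by simpa using hs⟩
  | cons x w ih =>
    intro s hs
    rw [List.flatMap_cons] at hs
    obtain ⟨l1, l2, rfl, h1, h2⟩ := List.sublist_append_iff.1 hs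
    obtain ⟨t, ht, htl, hts⟩ := ih l2 h2
    cases l1 with
    | nil => exact ⟨t, ht.cons x, by simpa using htl, by simpa using hts⟩
    | cons c l1 =>
      refine ⟨x :: t, ht.cons_cons x, by simp; omega, ?_⟩
      rw [List.flatMap_cons]
      exact h1.append hts

theorem SimEq.flatMap {X α : Type*} {n : ℕ} {w w' : List X} (h : SimEq n w w')
    (L : X → List α) : SimEq n (w.flatMap L) (w'.flatMap L) := by
  have key : ∀ w w' : List X, SimEq n w w' → ∀ s : List α, s.length ≤ n →
      s.Sublist (w.flatMap L) → s.Sublist (w'.flatMap L) := by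
    intro w w' h s hs hsub
    obtain ⟨t, ht, htl, hts⟩ := sub_flatMap L w s hsub
    exact hts.trans (((h t (by omega)).1 ht).flatMap L)
  exact fun s hs => ⟨key w w' h s hs, key w' w h.symm s hs⟩

theorem kisGen_fam (n : ℕ) : KisFam (kisGen n) := by
  have rel : ∀ u v, kisRel n u v → PresentedMonoid.mk (kisRel n) u = PresentedMonoid.mk (kisRel n) v :=
    fun u v h => PresentedMonoid.mk_eq_mk_of_rel h
  refine ⟨fun i => ?_, fun i j h => ?_, fun i j h => ?_⟩
  · exact rel _ _ (Or.inl ⟨i, rfl, rfl⟩)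
  · exact rel _ _ (Or.inr (Or.inl ⟨i, j, h, rfl, rfl⟩))
  · exact rel _ _ (Or.inr (Or.inr ⟨i, j, h, rfl, rfl⟩))

theorem hom_eq_ev {X M : Type*} [Monoid M] (φ : FreeMonoid X →* M) (w : FreeMonoid X) :
    φ w = ev (fun x => φ (FreeMonoid.of x)) w.toList := by
  have : φ = FreeMonoid.lift (fun x => φ (FreeMonoid.of x)) := by
    ext x; simp
  conv_lhs => rw [this]
  rw [FreeMonoid.lift_apply]; rfl

theorem ev_flatMap {X ι M : Type*} [Monoid M] (g : ι → M) (L : X → List ι) (w : List X) :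
    ev g (w.flatMap L) = ev (fun x => ev g (L x)) w := by
  induction w with
  | nil => simp [ev]
  | cons x w ih => rw [List.flatMap_cons, ev_append, ih, ev_cons]

theorem sim_kis {X : Type*} {n : ℕ} {w w' : FreeMonoid X} (h : SimEq n w.toList w'.toList)
    (φ : FreeMonoid X →* Kis n) : φ w = φ w' := by
  have hL : ∀ x : X, ∃ l : List (Fin n), ev (kisGen n) l = φ (FreeMonoid.of x) := by
    intro x
    obtain ⟨l, hl⟩ := PresentedMonoid.surjective_mk (φ (FreeMonoid.of x))
    refine ⟨l.toList, ?_⟩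
    rw [← hl, hom_eq_ev (PresentedMonoid.mk (kisRel n)) l]
    rfl
  choose L hL using hL
  rw [hom_eq_ev φ w, hom_eq_ev φ w']
  have e : (fun x => φ (FreeMonoid.of x)) = fun x => ev (kisGen n) (L x) := by
    funext x; exact (hL x).symm
  rw [e, ← ev_flatMap, ← ev_flatMap]
  exact main_kis (kisGen_fam n) _ [] _ _ rfl (h.flatMap L)

/-- The elementary move `i + 1 ↦ i`. -/
def mv (i t : ℕ) : ℕ := if t = i + 1 then i else t

/-- The move as an element of the opposite transformation monoid. -/
def mvE (i : ℕ) : (Function.End ℕ)ᵐᵒᵖ := MulOpposite.op (mv i)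

theorem mvE_ext {x y : (Function.End ℕ)ᵐᵒᵖ} (h : ∀ t : ℕ, x.unop t = y.unop t) : x = y :=
  MulOpposite.unop_injective (funext h)

theorem unop_mul_apply (x y : (Function.End ℕ)ᵐᵒᵖ) (t : ℕ) :
    (x * y).unop t = y.unop (x.unop t) := rfl

theorem mvE_apply (i t : ℕ) : (mvE i).unop t = if t = i + 1 then i else t := rfl

/-- The right action of the Catalan monoid on states. -/
def catAct (n : ℕ) : Cat n →* (Function.End ℕ)ᵐᵒᵖ :=
  PresentedMonoid.lift (rels := catRel n)
    (fun i : Fin n => mvE i) (by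
    intro u v h
    rcases h with ⟨i, rfl, rfl⟩ | ⟨i, k, h, rfl, rfl⟩ | ⟨i, j, h, rfl, rfl⟩ | ⟨i, j, h, rfl, rfl⟩
    all_goals
      simp only [map_mul, FreeMonoid.lift_eval_of]
      apply mvE_ext
      intro t
      simp only [unop_mul_apply, mvE_apply]
      grind)

/-- The action as a plain function. -/
def act {n : ℕ} (c : Cat n) (t : ℕ) : ℕ := (catAct n c).unop t

theorem act_one {n : ℕ} (t : ℕ) : act (1 : Cat n) t = t := by
  simp only [act, map_one]; rfl

theorem act_mul {n : ℕ} (c d : Cat n) (t : ℕ) : act (c * d) t = act d (act c t) := by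
  simp only [act, map_mul]; rfl

theorem act_gen {n : ℕ} (i : Fin n) (t : ℕ) : act (catGen n i) t = mv i t := by
  rfl

open Classical in
/-- Image of the letter `x` in the substitution detecting the word `s`. -/
noncomputable def theta {X : Type*} (n : ℕ) (x : X) : List X → Cat n
  | [] => 1
  | c :: s => theta n x s * (if h : x = c ∧ s.length < n then catGen n ⟨s.length, h.2⟩ else 1)

theorem theta_big {X : Type*} (n : ℕ) (x : X) (s : List X) (t : ℕ) (ht : s.length < t) :
    act (theta n x s) t = t := by
  induction s with
  | nil => exact act_one t
  | cons c s ih =>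
    simp only [List.length_cons] at ht
    rw [theta, act_mul, ih (by omega)]
    split_ifs with h
    · rw [act_gen, mv, if_neg]; simp; omega
    · exact act_one t

theorem theta_zero {X : Type*} (n : ℕ) (x : X) (s : List X) :
    act (theta n x s) 0 = 0 := by
  induction s with
  | nil => exact act_one 0
  | cons c s ih =>
    rw [theta, act_mul, ih]
    split_ifs with h
    · rw [act_gen, mv, if_neg]; omega
    · exact act_one 0

open Classical in
theorem theta_suffix {X : Type*} (n : ℕ) (x : X) (s : List X) (hs : s.length ≤ n) (c : X)
    (r : List X) (hr : (c :: r) <:+ s) :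
    act (theta n x s) (r.length + 1) = if x = c then r.length else r.length + 1 := by
  induction s with
  | nil => simp at hr
  | cons d s ih =>
    simp only [List.length_cons] at hs
    rw [theta, act_mul]
    rcases List.suffix_cons_iff.1 hr with h | h
    · obtain ⟨rfl, rfl⟩ := List.cons.inj h
      rw [theta_big n x _ _ (Nat.lt_succ_self _)]
      by_cases hx : x = c
      · rw [dif_pos ⟨hx, by omega⟩, if_pos hx, act_gen, mv]; simp
      · rw [dif_neg (fun h => hx h.1), if_neg hx, act_one]
    · have hl := h.length_le
      simp only [List.length_cons] at hl
      rw [ih (by omega) h]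
      split_ifs <;> first | exact act_one _ | (rw [act_gen, mv, if_neg]; simp; omega)

theorem detect {X : Type*} (n : ℕ) (s : List X) (hs : s.length ≤ n) (w : List X) :
    ∀ r : List X, r <:+ s →
      (act (ev (fun x => theta n x s) w) r.length = 0 ↔ r.Sublist w) := by
  classical
  induction w with
  | nil => intro r _; simp [ev, act_one]
  | cons x w ih =>
    intro r hr
    rw [ev_cons, act_mul]
    cases r with
    | nil =>
      rw [List.length_nil, theta_zero]
      have := ih [] (List.nil_suffix)
      simpa using this
    | cons c r =>
      rw [List.length_cons, theta_suffix n x s hs c r hr]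
      by_cases hx : x = c
      · subst hx
        rw [if_pos rfl, ih r ((List.suffix_cons _ _).trans hr), List.cons_sublist_cons]
      · rw [if_neg hx]
        have := ih (c :: r) hr
        rw [List.length_cons] at this
        rw [this]
        exact ⟨fun h => h.cons x, fun h => h.of_cons_of_ne (Ne.symm hx)⟩

theorem cat_sim {X : Type*} {n : ℕ} {w w' : FreeMonoid X}
    (h : ∀ φ : FreeMonoid X →* Cat n, φ w = φ w') : SimEq n w.toList w'.toList := by
  intro s hs
  have h1 := h (FreeMonoid.lift (fun x => theta n x s))
  rw [FreeMonoid.lift_apply, FreeMonoid.lift_apply] at h1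
  rw [← detect n s hs w.toList s List.suffix_rfl, ← detect n s hs w'.toList s List.suffix_rfl]
  unfold ev
  rw [h1]

/-- Identities pass to quotients. -/
theorem quot {X M N : Type*} [Monoid M] [Monoid N] (π : M →* N) (hπ : Function.Surjective π)
    {w w' : FreeMonoid X} (h : ∀ φ : FreeMonoid X →* M, φ w = φ w') (φ : FreeMonoid X →* N) :
    φ w = φ w' := by
  choose σ hσ using hπ
  have e : φ = π.comp (FreeMonoid.lift (fun x => σ (φ (FreeMonoid.of x)))) := by
    ext x; simp [hσ]
  rw [e, MonoidHom.comp_apply, MonoidHom.comp_apply, h]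

theorem lift_surj {ι : Type*} {r r' : FreeMonoid ι → FreeMonoid ι → Prop}
    (π : PresentedMonoid r →* PresentedMonoid r')
    (h : ∀ i, π (PresentedMonoid.of r i) = PresentedMonoid.of r' i) : Function.Surjective π := by
  intro y
  obtain ⟨l, rfl⟩ := PresentedMonoid.surjective_mk y
  refine ⟨PresentedMonoid.mk r l, ?_⟩
  have : π.comp (PresentedMonoid.mk r) = PresentedMonoid.mk r' := by
    ext i; exact h i
  exact DFunLike.congr_fun this l

theorem kis_styl (n : ℕ) : ∃ π : Kis n →* Styl n, Function.Surjective π := by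
  have rel : ∀ u v, stylRel n u v →
      PresentedMonoid.mk (stylRel n) u = PresentedMonoid.mk (stylRel n) v :=
    fun u v h => PresentedMonoid.mk_eq_mk_of_rel h
  have idem : ∀ i, stylGen n i * stylGen n i = stylGen n i :=
    fun i => rel _ _ (Or.inl ⟨i, rfl, rfl⟩)
  have r1 : ∀ i j, i < j → stylGen n j * stylGen n i * stylGen n i =
      stylGen n i * stylGen n j * stylGen n i :=
    fun i j h => rel _ _ (Or.inr (Or.inr (Or.inr (Or.inl ⟨i, j, h, rfl, rfl⟩))))
  have r2 : ∀ i j, i < j → stylGen n j * stylGen n j * stylGen n i =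
      stylGen n j * stylGen n i * stylGen n j :=
    fun i j h => rel _ _ (Or.inr (Or.inr (Or.inr (Or.inr ⟨i, j, h, rfl, rfl⟩))))
  refine ⟨PresentedMonoid.lift (stylGen n) ?_, lift_surj _ (fun i => rfl)⟩
  intro u v h
  rcases h with ⟨i, rfl, rfl⟩ | ⟨i, j, h, rfl, rfl⟩ | ⟨i, j, h, rfl, rfl⟩ <;>
    simp only [map_mul, FreeMonoid.lift_eval_of]
  · exact idem i
  · rw [← r1 i j h, mul_assoc, idem]
  · rw [← r2 i j h, idem]

theorem styl_cat (n : ℕ) : ∃ π : Styl n →* Cat n, Function.Surjective π := by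
  have rel : ∀ u v, catRel n u v →
      PresentedMonoid.mk (catRel n) u = PresentedMonoid.mk (catRel n) v :=
    fun u v h => PresentedMonoid.mk_eq_mk_of_rel h
  have idem : ∀ i, catGen n i * catGen n i = catGen n i :=
    fun i => rel _ _ (Or.inl ⟨i, rfl, rfl⟩)
  have comm : ∀ i k : Fin n, (i : ℕ) + 2 ≤ k → catGen n i * catGen n k = catGen n k * catGen n i :=
    fun i k h => rel _ _ (Or.inr (Or.inl ⟨i, k, Or.inl h, rfl, rfl⟩))
  have r1 : ∀ i j : Fin n, i < j → catGen n i * catGen n j * catGen n i =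
      catGen n j * catGen n i := by
    intro i j h
    have h' : (i : ℕ) < j := h
    by_cases hij : (i : ℕ) + 1 = j
    · exact rel _ _ (Or.inr (Or.inr (Or.inl ⟨i, j, hij, rfl, rfl⟩)))
    · rw [comm i j (by omega), mul_assoc, idem]
  have r2 : ∀ i j : Fin n, i < j → catGen n j * catGen n i * catGen n j =
      catGen n j * catGen n i := by
    intro i j h
    have h' : (i : ℕ) < j := h
    by_cases hij : (i : ℕ) + 1 = j
    · exact rel _ _ (Or.inr (Or.inr (Or.inr ⟨i, j, hij, rfl, rfl⟩)))
    · rw [mul_assoc, comm i j (by omega), ← mul_assoc, idem]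
  refine ⟨PresentedMonoid.lift (catGen n) ?_, lift_surj _ (fun i => rfl)⟩
  intro u v h
  rcases h with ⟨i, rfl, rfl⟩ | ⟨i, j, k, h1, h2, rfl, rfl⟩ | ⟨i, j, k, h1, h2, rfl, rfl⟩ |
    ⟨i, j, h, rfl, rfl⟩ | ⟨i, j, h, rfl, rfl⟩ <;>
    simp only [map_mul, FreeMonoid.lift_eval_of]
  · exact idem i
  · have h1' : (i : ℕ) < j := h1
    have h2' : (j : ℕ) < k := h2
    rw [mul_assoc, comm i k (by omega), mul_assoc]
  · have h1' : (i : ℕ) < j := h1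
    have h2' : (j : ℕ) < k := h2
    rw [comm i k (by omega)]
  · rw [r1 i j h, mul_assoc, idem]
  · rw [r2 i j h, idem]

end CSK

/-- For `n ≥ 2`, the monoids `Cat_n`, `Styl_n` and `Kis_n` satisfy exactly the same
identities: an identity `w = w'` holds in `Cat_n` iff it holds in `Styl_n` iff it
holds in `Kis_n`. -/
theorem catalan_stylic_kiselman_same_identities (n : ℕ) (hn : 2 ≤ n) (X : Type*)
    (w w' : FreeMonoid X) :
    ((∀ φ : FreeMonoid X →* Cat n, φ w = φ w') ↔ (∀ φ : FreeMonoid X →* Styl n, φ w = φ w')) ∧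
    ((∀ φ : FreeMonoid X →* Styl n, φ w = φ w') ↔ (∀ φ : FreeMonoid X →* Kis n, φ w = φ w')) := by
  obtain ⟨π, hπ⟩ := CSK.kis_styl n
  obtain ⟨ρ, hρ⟩ := CSK.styl_cat n
  have sc : (∀ φ : FreeMonoid X →* Styl n, φ w = φ w') → (∀ φ : FreeMonoid X →* Cat n, φ w = φ w') :=
    fun h => CSK.quot ρ hρ h
  have ks : (∀ φ : FreeMonoid X →* Kis n, φ w = φ w') → (∀ φ : FreeMonoid X →* Styl n, φ w = φ w') :=
    fun h => CSK.quot π hπ h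
  have ck : (∀ φ : FreeMonoid X →* Cat n, φ w = φ w') → (∀ φ : FreeMonoid X →* Kis n, φ w = φ w') :=
    fun h => CSK.sim_kis (CSK.cat_sim h)
  exact ⟨⟨fun h => ks (ck h), sc⟩, ⟨fun h => ck (sc h), ks⟩⟩
end

section
/- Let n ≥ 2 and let X be an alphabet. An identity w = w' over X holds in the stylic monoid Styl_n if and only if the words w and w' have the same set of scattered subwords of length at most n. -/
namespace StylProof

variable {n : ℕ}

/-- image of a word in the stylic monoid -/
def W (l : List (Fin n)) : Styl n := (l.map (stylGen n)).prod

lemma W_nil : W ([] : List (Fin n)) = 1 := rfl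
lemma W_cons (a : Fin n) (l : List (Fin n)) : W (a :: l) = stylGen n a * W l := by simp [W]
lemma W_append (l m : List (Fin n)) : W (l ++ m) = W l * W m := by simp [W]

lemma sound {u v : FreeMonoid (Fin n)} (h : stylRel n u v) :
    PresentedMonoid.mk (stylRel n) u = PresentedMonoid.mk (stylRel n) v :=
  PresentedMonoid.mk_eq_mk_of_rel h

lemma r_idem (i : Fin n) : stylGen n i * stylGen n i = stylGen n i :=
  sound (Or.inl ⟨i, rfl, rfl⟩)
lemma r_jik {i j k : Fin n} (h : i < j) (h' : j < k) :
    stylGen n j * stylGen n i * stylGen n k = stylGen n j * stylGen n k * stylGen n i :=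
  sound (Or.inr (Or.inl ⟨i, j, k, h, h', rfl, rfl⟩))
lemma r_ikj {i j k : Fin n} (h : i < j) (h' : j < k) :
    stylGen n i * stylGen n k * stylGen n j = stylGen n k * stylGen n i * stylGen n j :=
  sound (Or.inr (Or.inr (Or.inl ⟨i, j, k, h, h', rfl, rfl⟩)))
lemma r_iji {i j : Fin n} (h : i < j) :
    stylGen n i * stylGen n j * stylGen n i = stylGen n j * stylGen n i := by
  have : stylGen n j * stylGen n i * stylGen n i = stylGen n i * stylGen n j * stylGen n i :=
    sound (Or.inr (Or.inr (Or.inr (Or.inl ⟨i, j, h, rfl, rfl⟩))))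
  rw [← this, mul_assoc, r_idem]
lemma r_jij {i j : Fin n} (h : i < j) :
    stylGen n j * stylGen n i * stylGen n j = stylGen n j * stylGen n i := by
  have : stylGen n j * stylGen n j * stylGen n i = stylGen n j * stylGen n i * stylGen n j :=
    sound (Or.inr (Or.inr (Or.inr (Or.inr ⟨i, j, h, rfl, rfl⟩))))
  rw [← this, r_idem]

/-- move `x` right past an increasing word of smaller letters -/
lemma move_right (x y : Fin n) (hy : y < x) (P : List (Fin n)) (hP : (P ++ [y]).Pairwise (· < ·)) :
    stylGen n x * W (P ++ [y]) = W P * (stylGen n x * stylGen n y) := by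
  induction P with
  | nil => simp [W]
  | cons p P ih =>
    rw [List.cons_append, List.pairwise_cons] at hP
    have ih := ih hP.2
    have hpy : p < y := hP.1 y (by simp)
    obtain ⟨q, T, hq⟩ : ∃ q T, P ++ [y] = q :: T := by
      cases P with
      | nil => exact ⟨y, [], rfl⟩
      | cons a b => exact ⟨a, b ++ [y], rfl⟩
    have hpq : p < q := hP.1 q (by simp [hq])
    have hqx : q < x := by
      have : q ∈ P ++ [y] := by simp [hq]
      rcases List.mem_append.1 this with h | h
      · exact lt_trans ((List.pairwise_append.1 hP.2).2.2 q h y (by simp)) hy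
      · simp at h; exact h ▸ hy
    rw [List.cons_append, W_cons, W_cons, mul_assoc, ← ih, hq, W_cons]
    simp only [← mul_assoc]
    rw [r_ikj hpq hqx]

/-- move `y` right past an increasing word of larger letters, in the presence of `x` -/
lemma move_right' (y : Fin n) (Q : List (Fin n)) : ∀ (x : Fin n), y < x →
    (x :: Q).Pairwise (· < ·) →
    stylGen n x * stylGen n y * W Q = stylGen n x * W Q * stylGen n y := by
  induction Q with
  | nil => intro x _ _; simp [W]
  | cons q Q ih =>
    intro x hx hQ
    rw [List.pairwise_cons] at hQ
    have hxq : x < q := hQ.1 q (by simp)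
    have := ih q (hx.trans hxq) hQ.2
    rw [W_cons, ← mul_assoc, r_jik hx hxq]
    rw [mul_assoc (stylGen n x), mul_assoc (stylGen n x), this]
    simp only [mul_assoc]

/-- increasing word on the support of `w` -/
def R (w : List (Fin n)) : List (Fin n) := (List.finRange n).filter (· ∈ w)

lemma finRange_split (x : Fin n) : ∃ A B : List (Fin n), List.finRange n = A ++ x :: B ∧
    (∀ a ∈ A, a < x) ∧ (x :: B).Pairwise (· < ·) ∧ A.Pairwise (· < ·) ∧ (∀ a, a < x → a ∈ A) := by
  obtain ⟨A, B, h⟩ := List.append_of_mem (List.mem_finRange x)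
  have hp : (List.finRange n).Pairwise (· < ·) := List.pairwise_lt_finRange n
  rw [h, List.pairwise_append] at hp
  refine ⟨A, B, h, fun a ha => hp.2.2 a ha x (by simp), hp.2.1, hp.1, fun a ha => ?_⟩
  have := List.mem_finRange a
  rw [h] at this
  rcases List.mem_append.1 this with h1 | h1
  · exact h1
  · rcases List.mem_cons.1 h1 with h1 | h1
    · exact absurd h1 ha.ne
    · exact absurd ((List.pairwise_cons.1 hp.2.1).1 a h1) (not_lt.2 ha.le)

lemma R_split (x : Fin n) (w : List (Fin n)) : ∃ P Q : List (Fin n),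
    R (x :: w) = P ++ x :: Q ∧ R w = P ++ (if x ∈ w then x :: Q else Q) ∧
    P.Pairwise (· < ·) ∧ (x :: Q).Pairwise (· < ·) ∧ ∀ a, a ∈ P ↔ a ∈ w ∧ a < x := by
  obtain ⟨A, B, h, h1, h2, h3, h4⟩ := finRange_split x
  have hB := List.pairwise_cons.1 h2
  have eA : A.filter (· ∈ x :: w) = A.filter (· ∈ w) := by
    apply List.filter_congr
    intro a ha
    have := (h1 a ha).ne
    simp [this]
  have eB : B.filter (· ∈ x :: w) = B.filter (· ∈ w) := by
    apply List.filter_congr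
    intro a ha
    have := (hB.1 a ha).ne'
    simp [this]
  refine ⟨A.filter (· ∈ w), B.filter (· ∈ w), ?_, ?_, h3.filter _, ?_, ?_⟩
  · rw [R, h, List.filter_append, List.filter_cons, eA, eB]; simp
  · rw [R, h, List.filter_append, List.filter_cons]; simp
  · rw [List.pairwise_cons]
    refine ⟨fun a ha => hB.1 a (List.mem_filter.1 ha).1, hB.2.filter _⟩
  · intro a
    simp only [List.mem_filter, decide_eq_true_eq]
    exact ⟨fun h => ⟨h.2, h1 a h.1⟩, fun h => ⟨h4 a h.2, h.1⟩⟩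

lemma insert_none (x : Fin n) (w : List (Fin n)) (h : ∀ a ∈ w, x ≤ a) :
    stylGen n x * W (R w) = W (R (x :: w)) := by
  obtain ⟨P, Q, h1, h2, -, -, h5⟩ := R_split x w
  have : P = [] := by
    rw [List.eq_nil_iff_forall_not_mem]
    intro a ha
    have := (h5 a).1 ha
    exact absurd (h a this.1) (not_le.2 this.2)
  subst this
  rw [h1, h2]
  split_ifs
  · simp [W_cons, ← mul_assoc, r_idem]
  · simp [W_cons]

lemma insert_some (x y : Fin n) (w : List (Fin n)) (hy : y ∈ w) (hyx : y < x)
    (h : ∀ a ∈ w, a ≤ y ∨ x ≤ a) :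
    stylGen n x * W (R w) = W (R (x :: w)) * stylGen n y := by
  obtain ⟨P, Q, h1, h2, h3, h4, h5⟩ := R_split x w
  have hyP := (h5 y).2 ⟨hy, hyx⟩
  obtain rfl | ⟨P', z, rfl⟩ := List.eq_nil_or_concat P
  · simp at hyP
  simp only [List.concat_eq_append] at *
  have hz := (h5 z).1 (by simp)
  have hzy : z = y := by
    apply le_antisymm
    · exact (h z hz.1).resolve_right (not_le.2 hz.2)
    · rcases List.mem_append.1 hyP with h6 | h6
      · exact ((List.pairwise_append.1 h3).2.2 y h6 z (by simp)).le
      · simp at h6; exact h6.le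
  subst hzy
  have key : stylGen n x * stylGen n z * W (if x ∈ w then x :: Q else Q)
      = stylGen n z * (stylGen n x * W Q * stylGen n z) := by
    rw [← move_right' z Q x hyx h4]
    have e : stylGen n x * stylGen n z * W (if x ∈ w then x :: Q else Q)
        = stylGen n x * stylGen n z * W Q := by
      split_ifs
      · rw [W_cons, ← mul_assoc, r_jij hyx]
      · rfl
    rw [e, ← mul_assoc, ← mul_assoc, r_iji hyx]
  rw [h1, h2, W_append, ← mul_assoc, move_right x z hyx P' h3, mul_assoc, key]
  simp [W_append, W_cons, mul_assoc]

/-- `Bump w b`: `b` is the word of letters bumped when (left) inserting `w` in a row. -/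
inductive Bump : List (Fin n) → List (Fin n) → Prop
  | nil : Bump [] []
  | skip {x w b} : Bump w b → (∀ a ∈ w, x ≤ a) → Bump (x :: w) b
  | bump {x y w b} : Bump w b → y ∈ w → y < x → (∀ a ∈ w, a ≤ y ∨ x ≤ a) → Bump (x :: w) (y :: b)

lemma exists_bump (w : List (Fin n)) : ∃ b, Bump w b := by
  induction w with
  | nil => exact ⟨_, .nil⟩
  | cons x w ih =>
    obtain ⟨b, hb⟩ := ih
    by_cases h : ∀ a ∈ w, x ≤ a
    · exact ⟨_, .skip hb h⟩
    · push Not at h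
      obtain ⟨a, ha, hax⟩ := h
      obtain ⟨y, hy, hm⟩ := (w.toFinset.filter (· < x)).exists_max_image id
        ⟨a, by simp [ha, hax]⟩
      simp only [Finset.mem_filter, List.mem_toFinset, id] at hy hm
      refine ⟨_, .bump hb hy.1 hy.2 fun c hc => ?_⟩
      by_cases hcx : c < x
      · exact Or.inl (hm c ⟨hc, hcx⟩)
      · exact Or.inr (not_lt.1 hcx)

lemma Bump.W_eq {w b : List (Fin n)} (h : Bump w b) : W w = W (R w) * W b := by
  induction h with
  | nil => simp [R, W]
  | skip _ h ih => rw [W_cons, ih, ← mul_assoc, insert_none _ _ h]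
  | bump _ h1 h2 h3 ih =>
    rw [W_cons, ih, ← mul_assoc, insert_some _ _ _ h1 h2 h3, W_cons, mul_assoc]

lemma Bump.lt {w b : List (Fin n)} (h : Bump w b) : ∀ y ∈ b, ∃ x ∈ w, y < x := by
  induction h with
  | nil => simp
  | skip _ _ ih => intro y hy; obtain ⟨x, hx, h⟩ := ih y hy; exact ⟨x, by simp [hx], h⟩
  | @bump x z w b _ h1 h2 h3 ih =>
    intro y hy
    rcases List.mem_cons.1 hy with rfl | hy
    · exact ⟨x, by simp, h2⟩
    · obtain ⟨x, hx, h⟩ := ih y hy; exact ⟨x, by simp [hx], h⟩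

/-- There is a strictly decreasing scattered subword of length `k` with letters in `[i,j]`. -/
def Dec (w : List (Fin n)) (i j : Fin n) (k : ℕ) : Prop :=
  ∃ l : List (Fin n), l.Sublist w ∧ l.Pairwise (· > ·) ∧ (∀ a ∈ l, i ≤ a ∧ a ≤ j) ∧ l.length = k

lemma Bump.down {w b : List (Fin n)} (h : Bump w b) (i : Fin n) : ∀ (z : Fin n) (l : List (Fin n)),
    (z :: l).Sublist w → (z :: l).Pairwise (· > ·) → (∀ a ∈ l, i ≤ a) →
    ∃ m : List (Fin n), m.Sublist b ∧ m.Pairwise (· > ·) ∧ m.length = l.length ∧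
      (∀ a ∈ m, i ≤ a ∧ a < z ∧ a ∈ w) := by
  have mono : ∀ {w : List (Fin n)} {m : List (Fin n)} {z x : Fin n},
      (∀ a ∈ m, i ≤ a ∧ a < z ∧ a ∈ w) → (∀ a ∈ m, i ≤ a ∧ a < z ∧ a ∈ x :: w) :=
    fun h a ha => ⟨(h a ha).1, (h a ha).2.1, List.mem_cons_of_mem _ (h a ha).2.2⟩
  induction h with
  | nil => intro z l h; simp at h
  | @skip x w b _ h ih =>
    intro z l hs hp hi
    rcases List.cons_sublist_cons'.1 hs with hs | ⟨rfl, hs2⟩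
    · obtain ⟨m, h1, h2, h3, h4⟩ := ih z l hs hp hi
      exact ⟨m, h1, h2, h3, mono h4⟩
    · cases l with
      | nil => exact ⟨[], by simp⟩
      | cons c l =>
        have := (List.pairwise_cons.1 hp).1 c (by simp)
        exact absurd (h c (hs2.subset (by simp))) (not_le.2 this)
  | @bump x y w b _ h1 h2 h3 ih =>
    intro z l hs hp hi
    rcases List.cons_sublist_cons'.1 hs with hs | ⟨rfl, hs2⟩
    · obtain ⟨m, h1, h2, h3, h4⟩ := ih z l hs hp hi
      exact ⟨m, h1.cons _, h2, h3, mono h4⟩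
    · cases l with
      | nil => exact ⟨[], by simp⟩
      | cons c l =>
        have hp' := List.pairwise_cons.1 hp
        have hcz := hp'.1 c (by simp)
        have hcy : c ≤ y := (h3 c (hs2.subset (by simp))).resolve_right (not_le.2 hcz)
        obtain ⟨m, g1, g2, g3, g4⟩ := ih c l hs2 hp'.2 (fun a ha => hi a (by simp [ha]))
        refine ⟨y :: m, g1.cons_cons y, ?_, by simp [g3], ?_⟩
        · rw [List.pairwise_cons]
          exact ⟨fun a ha => lt_of_lt_of_le (g4 a ha).2.1 hcy, g2⟩
        · intro a ha
          rcases List.mem_cons.1 ha with rfl | ha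
          · exact ⟨(hi c (by simp)).trans hcy, h2, by simp [h1]⟩
          · exact ⟨(g4 a ha).1, ((g4 a ha).2.1.trans_le hcy).trans h2, by simp [(g4 a ha).2.2]⟩

lemma Bump.up {w b : List (Fin n)} (h : Bump w b) (i : Fin n) : ∀ (y : Fin n) (m : List (Fin n)),
    (y :: m).Sublist b → (y :: m).Pairwise (· > ·) → (∀ a ∈ y :: m, i ≤ a) →
    ∃ (t : List (Fin n)) (z : Fin n) (v l : List (Fin n)), w = t ++ z :: v ∧ l.Sublist v ∧
      l.length = m.length + 1 ∧ l.Pairwise (· > ·) ∧ (∀ a ∈ l, i ≤ a ∧ a ≤ y) ∧ y < z ∧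
      (∀ a ∈ v, a ≤ y ∨ z ≤ a) := by
  induction h with
  | nil => intro y m h; simp at h
  | @skip x w b _ h ih =>
    intro y m hs hp hi
    obtain ⟨t, z, v, l, rfl, hh⟩ := ih y m hs hp hi
    exact ⟨x :: t, z, v, l, rfl, hh⟩
  | @bump x y' w b _ h1 h2 h3 ih =>
    intro y m hs hp hi
    rcases List.cons_sublist_cons'.1 hs with hs | ⟨rfl, hs2⟩
    · obtain ⟨t, z, v, l, rfl, hh⟩ := ih y m hs hp hi
      exact ⟨x :: t, z, v, l, rfl, hh⟩
    · have hp' := List.pairwise_cons.1 hp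
      cases m with
      | nil =>
        refine ⟨[], x, w, [y], rfl, by simpa using h1, rfl, by simp, ?_, h2, h3⟩
        intro a ha
        simp at ha; subst ha
        exact ⟨hi a (by simp), le_rfl⟩
      | cons c m =>
        have hcy : c < y := hp'.1 c (by simp)
        obtain ⟨t, z, v, l, rfl, g1, g2, g3, g4, g5, g6⟩ :=
          ih c m hs2 hp'.2 (fun a ha => hi a (List.mem_cons_of_mem _ ha))
        by_cases hz : z ≤ y
        · refine ⟨[], x, _, z :: l, rfl, ?_, by simp [g2], ?_, ?_, h2, h3⟩
          · exact (g1.cons_cons z).trans (List.sublist_append_right _ _)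
          · rw [List.pairwise_cons]
            exact ⟨fun a ha => (g4 a ha).2.trans_lt g5, g3⟩
          · intro a ha
            rcases List.mem_cons.1 ha with rfl | ha
            · exact ⟨(hi c (by simp)).trans g5.le, hz⟩
            · exact ⟨(g4 a ha).1, (g4 a ha).2.trans hcy.le⟩
        · have hyt : y ∈ t := by
            rcases List.mem_append.1 h1 with h | h
            · exact h
            · rcases List.mem_cons.1 h with h | h
              · exact absurd h.ge hz
              · rcases g6 y h with h | h
                · exact absurd h (not_le.2 hcy)
                · exact absurd h hz
          refine ⟨[], x, _, y :: l, rfl, ?_, by simp [g2], ?_, ?_, h2, h3⟩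
          · exact (List.singleton_sublist.2 hyt).append (g1.cons z)
          · rw [List.pairwise_cons]
            exact ⟨fun a ha => (g4 a ha).2.trans_lt hcy, g3⟩
          · intro a ha
            rcases List.mem_cons.1 ha with rfl | ha
            · exact ⟨hi a (by simp), le_rfl⟩
            · exact ⟨(g4 a ha).1, (g4 a ha).2.trans hcy.le⟩

/-- `s` is the successor of `j` in the support of `w`, or `j` if there is none. -/
def IsSucc (w : List (Fin n)) (j s : Fin n) : Prop :=
  (s = j ∧ ∀ a ∈ w, a ≤ j) ∨ (s ∈ w ∧ j < s ∧ ∀ a ∈ w, a ≤ j ∨ s ≤ a)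

lemma exists_succ (w : List (Fin n)) (j : Fin n) : ∃ s, IsSucc w j s := by
  by_cases h : ∀ a ∈ w, a ≤ j
  · exact ⟨j, Or.inl ⟨rfl, h⟩⟩
  · push Not at h
    obtain ⟨a, ha, haj⟩ := h
    obtain ⟨y, hy, hm⟩ := (w.toFinset.filter (j < ·)).exists_min_image id
      ⟨a, by simp [ha, haj]⟩
    simp only [Finset.mem_filter, List.mem_toFinset, id] at hy hm
    refine ⟨y, Or.inr ⟨hy.1, hy.2, fun c hc => ?_⟩⟩
    by_cases hcx : j < c
    · exact Or.inr (hm c ⟨hc, hcx⟩)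
    · exact Or.inl (not_lt.1 hcx)

lemma Bump.dec_iff {w b : List (Fin n)} (h : Bump w b) {i j s : Fin n} (hs : IsSucc w j s) (k : ℕ) :
    Dec b i j (k + 1) ↔ Dec w i s (k + 2) := by
  constructor
  · rintro ⟨l, h1, h2, h3, h4⟩
    obtain _ | ⟨y, m⟩ := l
    · simp at h4
    obtain ⟨t, z, v, l, rfl, g1, g2, g3, g4, g5, g6⟩ := h.up i y m h1 h2 (fun a ha => (h3 a ha).1)
    have hy := h3 y (by simp)
    simp only [List.length_cons] at h4
    have hjs : j ≤ s := by rcases hs with hs | hs; exacts [hs.1.ge, hs.2.1.le]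
    by_cases hzs : z ≤ s
    · refine ⟨z :: l, (g1.cons_cons z).trans (List.sublist_append_right _ _), ?_, ?_,
        by simp only [List.length_cons]; omega⟩
      · rw [List.pairwise_cons]
        exact ⟨fun a ha => (g4 a ha).2.trans_lt g5, g3⟩
      · intro a ha
        rcases List.mem_cons.1 ha with rfl | ha
        · exact ⟨hy.1.trans g5.le, hzs⟩
        · exact ⟨(g4 a ha).1, (g4 a ha).2.trans (hy.2.trans hjs)⟩
    · rcases hs with ⟨rfl, hs⟩ | ⟨hs1, hs2, hs3⟩
      · exact absurd (hs z (by simp)) hzs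
      have hyt : s ∈ t := by
        rcases List.mem_append.1 hs1 with h | h
        · exact h
        · rcases List.mem_cons.1 h with h | h
          · exact absurd h.ge hzs
          · rcases g6 s h with h | h
            · exact absurd (h.trans hy.2) (not_le.2 hs2)
            · exact absurd h hzs
      refine ⟨s :: l, (List.singleton_sublist.2 hyt).append (g1.cons z), ?_, ?_,
        by simp only [List.length_cons]; omega⟩
      · rw [List.pairwise_cons]
        exact ⟨fun a ha => ((g4 a ha).2.trans hy.2).trans_lt hs2, g3⟩
      · intro a ha
        rcases List.mem_cons.1 ha with rfl | ha
        · exact ⟨(hy.1.trans hy.2).trans hjs, le_rfl⟩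
        · exact ⟨(g4 a ha).1, (g4 a ha).2.trans (hy.2.trans hjs)⟩
  · rintro ⟨l, h1, h2, h3, h4⟩
    obtain _ | ⟨z, l⟩ := l
    · simp at h4
    simp only [List.length_cons] at h4
    obtain ⟨m, g1, g2, g3, g4⟩ := h.down i z l h1 h2 (fun a ha => (h3 a (by simp [ha])).1)
    refine ⟨m, g1, g2, fun a ha => ⟨(g4 a ha).1, ?_⟩, by omega⟩
    have hz := (h3 z (by simp)).2
    have ha' := g4 a ha
    rcases hs with ⟨rfl, hs⟩ | ⟨hs1, hs2, hs3⟩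
    · exact hs a ha'.2.2
    · exact (hs3 a ha'.2.2).resolve_right (not_le.2 (ha'.2.1.trans_le hz))

lemma mem_iff_dec (w : List (Fin n)) (a : Fin n) : a ∈ w ↔ Dec w a a 1 := by
  constructor
  · intro h
    refine ⟨[a], by simpa using h, by simp, by simp, rfl⟩
  · rintro ⟨l, h1, -, h3, h4⟩
    obtain ⟨c, rfl⟩ := List.length_eq_one_iff.1 h4
    have := h3 c (by simp)
    have : c = a := le_antisymm this.2 this.1
    subst this
    simpa using h1

theorem W_eq_of_dec (N : ℕ) : ∀ w w' : List (Fin n), (∀ a ∈ w, a.val < N) →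
    (∀ i j k, Dec w i j k ↔ Dec w' i j k) → W w = W w' := by
  induction N with
  | zero =>
    intro w w' h hd
    have h1 : w = [] := List.eq_nil_iff_forall_not_mem.2 fun a ha => by simpa using h a ha
    have h2 : w' = [] := List.eq_nil_iff_forall_not_mem.2 fun a ha => by
      rw [mem_iff_dec, ← hd, ← mem_iff_dec, h1] at ha
      simp at ha
    rw [h1, h2]
  | succ N ih =>
    intro w w' h hd
    have hm : ∀ a, a ∈ w ↔ a ∈ w' := fun a => by rw [mem_iff_dec, hd, ← mem_iff_dec]
    obtain ⟨b, hb⟩ := exists_bump w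
    obtain ⟨b', hb'⟩ := exists_bump w'
    have hR : R w = R w' := by
      unfold R
      apply List.filter_congr
      intro a _
      simp [hm a]
    rw [hb.W_eq, hb'.W_eq, hR, ih b b']
    · intro a ha
      obtain ⟨x, hx, hax⟩ := hb.lt a ha
      have := h x hx
      have : a.val < x.val := hax
      omega
    · intro i j k
      cases k with
      | zero => exact ⟨fun _ => ⟨[], by simp⟩, fun _ => ⟨[], by simp⟩⟩
      | succ k =>
        obtain ⟨s, hs⟩ := exists_succ w j
        have hs' : IsSucc w' j s := by simpa only [IsSucc, hm] using hs
        rw [hb.dec_iff hs, hb'.dec_iff hs', hd]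

lemma sublist_flatMap {X Y : Type*} (f : X → List Y) (w : List X) : ∀ l : List Y,
    l.Sublist (w.flatMap f) →
    ∃ u : List X, u.Sublist w ∧ u.length ≤ l.length ∧ l.Sublist (u.flatMap f) := by
  induction w with
  | nil => intro l h; exact ⟨[], by simpa using h⟩
  | cons x w ih =>
    intro l h
    rw [List.flatMap_cons] at h
    obtain ⟨l1, l2, rfl, h1, h2⟩ := List.sublist_append_iff.1 h
    obtain ⟨u, g1, g2, g3⟩ := ih l2 h2
    by_cases hl : l1 = []
    · subst hl
      exact ⟨u, g1.cons _, by simpa using g2, by simpa using g3⟩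
    · refine ⟨x :: u, g1.cons_cons x, ?_, ?_⟩
      · have := List.length_pos_iff.2 hl
        simp only [List.length_cons, List.length_append]; omega
      · rw [List.flatMap_cons]; exact h1.append g3

lemma sublist_flatMap_mono {X Y : Type*} (f : X → List Y) {u w : List X} (h : u.Sublist w) :
    (u.flatMap f).Sublist (w.flatMap f) := by
  induction h with
  | slnil => simp
  | cons a _ ih => rw [List.flatMap_cons]; exact ih.trans (List.sublist_append_right _ _)
  | cons_cons a _ ih => simp only [List.flatMap_cons]; exact (List.Sublist.refl _).append ih

lemma dec_of_sub {X : Type*} (f : X → List (Fin n)) (w w' : List X)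
    (h : ∀ u : List X, u.length ≤ n → u.Sublist w → u.Sublist w') (i j : Fin n) (k : ℕ) :
    Dec (w.flatMap f) i j k → Dec (w'.flatMap f) i j k := by
  rintro ⟨l, h1, h2, h3⟩
  refine ⟨l, ?_, h2, h3⟩
  have hn : l.Nodup := h2.imp (fun h => ne_of_gt h)
  have hl : l.length ≤ n := by simpa using hn.length_le_card
  obtain ⟨u, g1, g2, g3⟩ := sublist_flatMap f w l h1
  exact g3.trans (sublist_flatMap_mono f (h u (g2.trans hl) g1))

lemma W_surj (s : Styl n) : ∃ l, W l = s := by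
  induction s using PresentedMonoid.inductionOn with
  | _ z =>
    refine ⟨z.toList, ?_⟩
    induction z using FreeMonoid.inductionOn' with
    | one => rfl
    | of_mul x xs ih =>
      rw [FreeMonoid.toList_of_mul, W_cons, ih, map_mul]; rfl

lemma hom_eq {X : Type*} (φ : FreeMonoid X →* Styl n) (f : X → List (Fin n))
    (hf : ∀ x, W (f x) = φ (.of x)) (w : FreeMonoid X) : φ w = W (w.toList.flatMap f) := by
  induction w using FreeMonoid.inductionOn' with
  | one => simp [W]
  | of_mul x xs ih =>
    rw [map_mul, ih, FreeMonoid.toList_of_mul, List.flatMap_cons, W_append, hf]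

/-! ### The other direction -/

/-- elementary step -/
def step (i : ℕ) : Function.End ℕ := fun p => if p = i then p + 1 else p

lemma mul_app (f g : Function.End ℕ) (p : ℕ) : (f * g) p = f (g p) := rfl

lemma step_rel (u v : FreeMonoid (Fin n)) (h : stylRel n u v) :
    FreeMonoid.lift (fun i : Fin n => step i.val) u = FreeMonoid.lift (fun i : Fin n => step i.val) v := by
  rcases h with ⟨i, rfl, rfl⟩ | ⟨i, j, k, h, h', rfl, rfl⟩ | ⟨i, j, k, h, h', rfl, rfl⟩ |
    ⟨i, j, h, rfl, rfl⟩ | ⟨i, j, h, rfl, rfl⟩ <;>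
  · try simp only [Fin.lt_def] at *
    simp only [map_mul, FreeMonoid.lift_eval_of]
    funext p
    simp only [mul_app, step]
    grind

/-- Action of the stylic monoid on states. -/
def act : Styl n →* Function.End ℕ :=
  PresentedMonoid.lift (fun i : Fin n => step i.val) step_rel

lemma act_gen (i : Fin n) : act (stylGen n i) = step i.val := PresentedMonoid.lift_of _ _

lemma act_W (l : List (Fin n)) (hl : l.Pairwise (· < ·)) (p : ℕ) :
    act (W l) p = if ∃ a ∈ l, a.val = p then p + 1 else p := by
  induction l with
  | nil => simp [W]; rfl
  | cons a l ih =>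
    rw [List.pairwise_cons] at hl
    rw [W_cons, map_mul, act_gen, mul_app, ih hl.2]
    have : ∀ b ∈ l, a.val < b.val := hl.1
    by_cases h : ∃ b ∈ l, b.val = p
    · obtain ⟨b, hb, hbp⟩ := h
      have := this b hb
      rw [if_pos ⟨b, hb, hbp⟩, if_pos ⟨b, by simp [hb], hbp⟩]
      simp only [step]; rw [if_neg]; omega
    · rw [if_neg h]
      have e : (∃ b ∈ a :: l, b.val = p) ↔ p = a.val := by
        constructor
        · rintro ⟨b, hb, hbp⟩
          rcases List.mem_cons.1 hb with rfl | hb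
          · exact hbp.symm
          · exact absurd ⟨b, hb, hbp⟩ h
        · intro hp
          exact ⟨a, by simp, hp.symm⟩
      simp only [step, e]

/-- letters of the image of `x` -/
noncomputable def pos {X : Type*} (n : ℕ) (u : List X) (x : X) : List (Fin n) :=
  open Classical in (List.finRange n).filter (fun i => u.reverse[i.val]? = some x)

lemma act_pos {X : Type*} (u : List X) (hu : u.length ≤ n) (x : X) (p : ℕ) :
    (act (W (pos n u x)) p = p + 1 ∧ u.reverse[p]? = some x) ∨
    (act (W (pos n u x)) p = p ∧ u.reverse[p]? ≠ some x) := by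
  classical
  have hsort : (pos n u x).Pairwise (· < ·) := (List.pairwise_lt_finRange n).filter _
  rw [act_W _ hsort]
  have : (∃ a ∈ pos n u x, a.val = p) ↔ u.reverse[p]? = some x := by
    constructor
    · rintro ⟨a, ha, rfl⟩
      simpa [pos] using (List.mem_filter.1 ha).2
    · intro h
      obtain ⟨h1, h2⟩ := List.getElem?_eq_some_iff.1 h
      rw [List.length_reverse] at h1
      exact ⟨⟨p, by omega⟩, by simp [pos, h], rfl⟩
  by_cases h : u.reverse[p]? = some x
  · left; rw [if_pos (this.2 h)]; exact ⟨rfl, h⟩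
  · right; rw [if_neg (fun g => h (this.1 g))]; exact ⟨rfl, h⟩

lemma hom_act {X : Type*} (u : List X) (hu : u.length ≤ n) (v : List X) :
    ∃ s, act (FreeMonoid.lift (fun x => W (pos n u x)) (FreeMonoid.ofList v)) 0 = s ∧
      s ≤ u.length ∧ ∀ t, t ≤ u.length → (((u.reverse.take t).reverse).Sublist v ↔ t ≤ s) := by
  induction v with
  | nil =>
    refine ⟨0, by simp; rfl, by omega, ?_⟩
    intro t ht
    rw [List.sublist_nil, List.reverse_eq_nil_iff, ← List.length_eq_zero_iff]
    simp only [List.length_reverse, List.length_take]; omega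
  | cons x v ih =>
    obtain ⟨s, h1, h2, h3⟩ := ih
    rw [FreeMonoid.ofList_cons, map_mul, map_mul, mul_app, h1,
      FreeMonoid.lift_eval_of]
    have expand : ∀ t, t < u.length → ∃ c, u.reverse[t]? = some c ∧
        (u.reverse.take (t+1)).reverse = c :: (u.reverse.take t).reverse := by
      intro t ht
      have : t < u.reverse.length := by simpa using ht
      refine ⟨_, List.getElem?_eq_getElem this, ?_⟩
      rw [List.take_succ_eq_append_getElem this]; simp
    rcases act_pos u hu x s with ⟨g1, g2⟩ | ⟨g1, g2⟩
    · refine ⟨s + 1, g1, ?_, ?_⟩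
      · have := (List.getElem?_eq_some_iff.1 g2).1
        simp at this; omega
      · intro t ht
        cases t with
        | zero => simp
        | succ t =>
          obtain ⟨c, hc, e⟩ := expand t (by omega)
          rw [e, List.cons_sublist_cons', ← e, h3 _ ht, h3 t (by omega)]
          grind
    · refine ⟨s, g1, h2, ?_⟩
      intro t ht
      cases t with
      | zero => simp
      | succ t =>
        obtain ⟨c, hc, e⟩ := expand t (by omega)
        rw [e, List.cons_sublist_cons', ← e, h3 _ ht, h3 t (by omega)]
        grind

lemma sub_of_identity {X : Type*} (w w' : FreeMonoid X)
    (h : ∀ φ : FreeMonoid X →* Styl n, φ w = φ w') (u : List X) (hu : u.length ≤ n)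
    (hs : u.Sublist w.toList) : u.Sublist w'.toList := by
  obtain ⟨s, h1, h2, h3⟩ := hom_act u hu w.toList
  obtain ⟨s', h1', h2', h3'⟩ := hom_act u hu w'.toList
  rw [FreeMonoid.ofList_toList] at h1 h1'
  rw [h, h1'] at h1
  subst h1
  have e : (u.reverse.take u.length).reverse = u := by
    rw [List.take_of_length_le (by simp), List.reverse_reverse]
  have a := h3 u.length le_rfl
  have b := h3' u.length le_rfl
  rw [e] at a b
  exact b.2 (a.1 hs)

end StylProof

/-- For `n ≥ 2`, an identity `w = w'` holds in the stylic monoid `Styl_n` if and only if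
`w` and `w'` have the same set of scattered subwords (subsequences) of length at most `n`. -/
theorem stylic_identity_iff_same_scattered_subwords (n : ℕ) (hn : 2 ≤ n) (X : Type*)
    (w w' : FreeMonoid X) :
    (∀ φ : FreeMonoid X →* Styl n, φ w = φ w') ↔
      {u : List X | u.length ≤ n ∧ u.Sublist (FreeMonoid.toList w)} =
        {u : List X | u.length ≤ n ∧ u.Sublist (FreeMonoid.toList w')} := by
  open StylProof in
  constructor
  · intro h
    ext u
    exact ⟨fun g => ⟨g.1, sub_of_identity w w' h u g.1 g.2⟩,
      fun g => ⟨g.1, sub_of_identity w' w (fun φ => (h φ).symm) u g.1 g.2⟩⟩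
  · intro h φ
    choose f hf using fun x => W_surj (φ (.of x))
    rw [hom_eq φ f hf, hom_eq φ f hf]
    have h' : ∀ u : List X, (u.length ≤ n ∧ u.Sublist w.toList) ↔
      (u.length ≤ n ∧ u.Sublist w'.toList) := fun u => Set.ext_iff.1 h u
    refine W_eq_of_dec n _ _ (fun a _ => a.isLt) fun i j k => ⟨?_, ?_⟩
    · exact dec_of_sub f _ _ (fun u h1 h2 => ((h' u).1 ⟨h1, h2⟩).2) i j k
    · exact dec_of_sub f _ _ (fun u h1 h2 => ((h' u).2 ⟨h1, h2⟩).2) i j k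
end

section
/- Let n ≥ 2 and let X be an alphabet. If the identity w = w' holds in the stylic monoid Styl_n for words w, w' ∈ X*, then w and w' have the same set of scattered subwords of length at most n. -/
/-- Letter `i` moves state `i` to state `i + 1` and fixes the others. -/
def stepEnd (i : ℕ) : Function.End ℕ := fun s => if s = i then i + 1 else s

lemma stepEnd_apply (i s : ℕ) : stepEnd i s = if s = i then i + 1 else s := rfl

lemma end_mul_apply (f g : Function.End ℕ) (s : ℕ) : (f * g) s = f (g s) := rfl

/-- The action of the stylic monoid on states. -/
def stylAct (n : ℕ) : Styl n →* Function.End ℕ :=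
  PresentedMonoid.lift (fun i : Fin n => stepEnd i) (by
    rintro a b (⟨i, rfl, rfl⟩ | ⟨i, j, k, hij, hjk, rfl, rfl⟩ | ⟨i, j, k, hij, hjk, rfl, rfl⟩ |
      ⟨i, j, hij, rfl, rfl⟩ | ⟨i, j, hij, rfl, rfl⟩) <;>
    simp only [map_mul, FreeMonoid.lift_eval_of] <;>
    funext s <;>
    simp only [end_mul_apply, stepEnd_apply] <;>
    (try simp only [Fin.lt_def] at *) <;>
    grind)

lemma stylAct_gen (n : ℕ) (i : Fin n) : stylAct n (stylGen n i) = stepEnd i := rfl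

open Classical in
/-- The letter image. -/
noncomputable def letterImg (n : ℕ) {X : Type*} (v : List X) (x : X) (l : List (Fin n)) : Styl n :=
  (l.map fun i : Fin n => if v[(i : ℕ)]? = some x then stylGen n i else 1).prod

open Classical in
lemma act_letterImg (n : ℕ) {X : Type*} (v : List X) (x : X) (l : List (Fin n))
    (hl : l.Pairwise (· < ·)) (s : ℕ) :
    stylAct n (letterImg n v x l) s =
      if (∃ i ∈ l, (i : ℕ) = s) ∧ v[s]? = some x then s + 1 else s := by
  induction l with
  | nil => simp [letterImg]; rfl
  | cons a l ih =>
    rw [List.pairwise_cons] at hl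
    have ih := ih hl.2
    have h1 : letterImg n v x (a :: l) =
      (if v[(a : ℕ)]? = some x then stylGen n a else 1) * letterImg n v x l := by
      simp [letterImg]
    rw [h1, map_mul, end_mul_apply, ih]
    have hlt : ∀ i ∈ l, (a : ℕ) < i := fun i hi => hl.1 i hi
    by_cases hv : v[(a : ℕ)]? = some x
    · rw [if_pos hv, stylAct_gen]
      by_cases hs : v[s]? = some x
      · by_cases hm : ∃ i ∈ l, (i : ℕ) = s
        · obtain ⟨i, hi, his⟩ := hm
          have hai := hlt i hi
          rw [if_pos ⟨⟨i, hi, his⟩, hs⟩, if_pos ⟨⟨i, List.mem_cons_of_mem _ hi, his⟩, hs⟩]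
          exact if_neg (by omega)
        · rw [if_neg (fun h => hm h.1), stepEnd_apply]
          by_cases hsa : s = a
          · rw [if_pos hsa, if_pos ⟨⟨a, List.mem_cons_self, hsa.symm⟩, hs⟩, hsa]
          · rw [if_neg hsa, if_neg]
            rintro ⟨⟨i, hi, his⟩, -⟩
            rcases List.mem_cons.1 hi with rfl | hi
            · exact hsa his.symm
            · exact hm ⟨i, hi, his⟩
      · rw [if_neg (fun h => hs h.2), if_neg (fun h => hs h.2)]
        exact if_neg (fun h : s = (a : ℕ) => hs (by rw [h]; exact hv))
    · rw [if_neg hv, map_one]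
      change (if _ then _ else _) = _
      congr 1
      simp only [eq_iff_iff]
      refine and_congr_left fun hs => ⟨fun ⟨i, hi, his⟩ => ⟨i, List.mem_cons_of_mem _ hi, his⟩, ?_⟩
      rintro ⟨i, hi, his⟩
      rcases List.mem_cons.1 hi with rfl | hi
      · exact absurd (his ▸ hs) hv
      · exact ⟨i, hi, his⟩

open Classical in
lemma foldr_iff {X : Type*} (v : List X) (r : List X) : ∀ s : ℕ,
    v.length ≤ r.foldl (fun s x => if v[s]? = some x then s + 1 else s) s ↔
      (v.drop s).Sublist r := by
  induction r with
  | nil => intro s; simp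
  | cons x r ih =>
    intro s
    rw [List.foldl_cons, ih]
    by_cases hs : s < v.length
    · rw [List.drop_eq_getElem_cons hs, List.getElem?_eq_getElem hs]
      by_cases hx : v[s] = x
      · simp [hx]
      · rw [if_neg (by simpa using hx), List.drop_eq_getElem_cons hs]
        constructor
        · exact fun h => h.cons _
        · intro h
          cases h with
          | cons _ h => exact h
          | cons_cons _ h => exact absurd rfl hx
    · have h0 : v.drop s = [] := List.drop_eq_nil_of_le (by omega)
      have h1 : v[s]? = none := List.getElem?_eq_none (by omega)
      simp [h0, h1]

open Classical in
lemma act_word (n : ℕ) {X : Type*} (v : List X) (hv : v.length ≤ n) (l : List X) (s : ℕ) :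
    stylAct n (FreeMonoid.lift (fun x => letterImg n v x (List.finRange n)) (FreeMonoid.ofList l)) s
      = l.reverse.foldl (fun s x => if v[s]? = some x then s + 1 else s) s := by
  induction l with
  | nil => simp; rfl
  | cons x l ih =>
    rw [FreeMonoid.ofList_cons, map_mul, map_mul, end_mul_apply, ih, FreeMonoid.lift_eval_of,
      act_letterImg n v x _ (List.pairwise_lt_finRange n), List.reverse_cons, List.foldl_append]
    simp only [List.foldl_cons, List.foldl_nil]
    congr 1
    simp only [eq_iff_iff, and_iff_right_iff_imp]
    intro h
    obtain ⟨h, -⟩ := List.getElem?_eq_some_iff.1 h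
    exact ⟨⟨_, lt_of_lt_of_le h hv⟩, List.mem_finRange _, rfl⟩

lemma sublist_iff_act (n : ℕ) {X : Type*} (u : List X) (hu : u.length ≤ n) (w : FreeMonoid X) :
    u.Sublist (FreeMonoid.toList w) ↔ u.length ≤
      stylAct n (FreeMonoid.lift (fun x => letterImg n u.reverse x (List.finRange n)) w) 0 := by
  have h := act_word n u.reverse (by simpa using hu) (FreeMonoid.toList w) 0
  rw [FreeMonoid.ofList_toList] at h
  rw [h]
  have h2 := foldr_iff u.reverse (FreeMonoid.toList w).reverse 0
  rw [List.length_reverse] at h2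
  rw [h2]
  simp

/-- For `n ≥ 2`, if the identity `w = w'` holds in the stylic monoid `Styl_n`, then `w` and
`w'` have the same set of scattered subwords (subsequences) of length at most `n`. -/
theorem stylic_identity_imp_same_scattered_subwords (n : ℕ) (hn : 2 ≤ n) (X : Type*)
    (w w' : FreeMonoid X) (h : ∀ φ : FreeMonoid X →* Styl n, φ w = φ w') :
    {u : List X | u.length ≤ n ∧ u.Sublist (FreeMonoid.toList w)} =
      {u : List X | u.length ≤ n ∧ u.Sublist (FreeMonoid.toList w')} := by
  ext u
  simp only [Set.mem_ofPred_eq]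
  refine and_congr_right fun hu => ?_
  rw [sublist_iff_act n u hu, sublist_iff_act n u hu, h]
end

section
/- The identities xyxzx = xyzx and (xy)² = (yx)² (over a three-letter alphabet {x, y, z}) hold in the stylic monoid Styl_2. -/
theorem stylTwo_mk_eq {u v : FreeMonoid (Fin 2)} (h : stylRel 2 u v) :
    PresentedMonoid.mk (stylRel 2) u = PresentedMonoid.mk (stylRel 2) v :=
  (Con.eq _).2 (ConGen.Rel.of _ _ h)

theorem stylTwo_idem (i : Fin 2) : stylGen 2 i * stylGen 2 i = stylGen 2 i :=
  stylTwo_mk_eq (Or.inl ⟨i, rfl, rfl⟩)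

theorem stylTwo_aba :
    stylGen 2 0 * (stylGen 2 1 * stylGen 2 0) = stylGen 2 1 * stylGen 2 0 := by
  have h : stylGen 2 1 * stylGen 2 0 * stylGen 2 0 = stylGen 2 0 * stylGen 2 1 * stylGen 2 0 :=
    stylTwo_mk_eq (Or.inr (Or.inr (Or.inr (Or.inl ⟨0, 1, by decide, rfl, rfl⟩))))
  rw [mul_assoc, mul_assoc, stylTwo_idem] at h
  exact h.symm

theorem stylTwo_bab :
    stylGen 2 1 * (stylGen 2 0 * stylGen 2 1) = stylGen 2 1 * stylGen 2 0 := by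
  have h : stylGen 2 1 * stylGen 2 1 * stylGen 2 0 = stylGen 2 1 * stylGen 2 0 * stylGen 2 1 :=
    stylTwo_mk_eq (Or.inr (Or.inr (Or.inr (Or.inr ⟨0, 1, by decide, rfl, rfl⟩))))
  rw [stylTwo_idem, mul_assoc] at h
  exact h.symm

theorem stylTwo_idem_assoc (i : Fin 2) (t : Styl 2) :
    stylGen 2 i * (stylGen 2 i * t) = stylGen 2 i * t := by
  rw [← mul_assoc, stylTwo_idem]

theorem stylTwo_aba_assoc (t : Styl 2) :
    stylGen 2 0 * (stylGen 2 1 * (stylGen 2 0 * t)) = stylGen 2 1 * (stylGen 2 0 * t) := by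
  have h := congrArg (· * t) stylTwo_aba
  simpa only [mul_assoc] using h

theorem stylTwo_bab_assoc (t : Styl 2) :
    stylGen 2 1 * (stylGen 2 0 * (stylGen 2 1 * t)) = stylGen 2 1 * (stylGen 2 0 * t) := by
  have h := congrArg (· * t) stylTwo_bab
  simpa only [mul_assoc] using h

/-- Every element of `Styl_2` is one of `1, a, b, ab, ba`. -/
theorem stylTwo_cases (x : Styl 2) :
    x = 1 ∨ x = stylGen 2 0 ∨ x = stylGen 2 1 ∨ x = stylGen 2 0 * stylGen 2 1 ∨
      x = stylGen 2 1 * stylGen 2 0 := by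
  induction x using PresentedMonoid.inductionOn with
  | _ w =>
    induction w using FreeMonoid.recOn with
    | one => exact Or.inl rfl
    | of_mul i w ih =>
      rw [map_mul]
      change stylGen 2 i * _ = _ ∨ stylGen 2 i * _ = _ ∨ stylGen 2 i * _ = _ ∨
        stylGen 2 i * _ = _ ∨ stylGen 2 i * _ = _
      fin_cases i <;> rcases ih with h | h | h | h | h <;> rw [h] <;>
        simp [stylTwo_idem, stylTwo_aba, stylTwo_bab, stylTwo_idem_assoc]

/-- The identities `xyxzx = xyzx` and `(xy)² = (yx)²` hold in the stylic monoid `Styl_2`. -/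
theorem styl_two_satisfies_basis_identities :
    (∀ x y z : Styl 2, x * y * x * z * x = x * y * z * x) ∧
    (∀ x y : Styl 2, (x * y) ^ 2 = (y * x) ^ 2) := by
  constructor
  · intro x y z
    rcases stylTwo_cases x with h | h | h | h | h <;>
    rcases stylTwo_cases y with hy | hy | hy | hy | hy <;>
    rcases stylTwo_cases z with hz | hz | hz | hz | hz <;>
    rw [h, hy, hz] <;>
    simp only [mul_assoc, mul_one, one_mul, stylTwo_idem, stylTwo_aba, stylTwo_bab,
      stylTwo_idem_assoc]
  · intro x y
    rcases stylTwo_cases x with h | h | h | h | h <;>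
    rcases stylTwo_cases y with hy | hy | hy | hy | hy <;>
    rw [h, hy] <;>
    simp only [pow_two, mul_assoc, mul_one, one_mul, stylTwo_idem, stylTwo_aba, stylTwo_bab,
      stylTwo_idem_assoc]
end

section
/- Every monoid identity w = w' (over any alphabet X) that holds in the stylic monoid Styl_2 follows from the two identities xyxzx = xyzx and (xy)² = (yx)²; that is, every monoid satisfying xyxzx = xyzx and (xy)² = (yx)² also satisfies w = w'. -/
/-- `x` followed by `z` is a scattered subword of the list. -/
def StyPr {X : Type*} (x z : X) : List X → Prop
  | [] => False
  | y :: l => (y = x ∧ z ∈ l) ∨ StyPr x z l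

theorem styPr_append {X : Type*} (x z : X) (A B : List X) :
    StyPr x z (A ++ B) ↔ StyPr x z A ∨ StyPr x z B ∨ (x ∈ A ∧ z ∈ B) := by
  induction A with
  | nil => simp [StyPr]
  | cons y A ih =>
    simp only [List.cons_append, StyPr, ih, List.mem_append, List.mem_cons]
    grind

theorem styPr_mem {X : Type*} {x z : X} {A : List X} (h : StyPr x z A) : x ∈ A ∧ z ∈ A := by
  induction A with
  | nil => simp [StyPr] at h
  | cons y A ih => 
    simp only [StyPr] at h
    grind

theorem styPr_self {X : Type*} [DecidableEq X] (x : X) (A : List X) :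
    StyPr x x A ↔ 2 ≤ A.count x := by
  induction A with
  | nil => simp [StyPr]
  | cons y A ih =>
    simp only [StyPr, ih, List.count_cons, ← List.count_pos_iff (a := x)]
    by_cases h : y = x
    · simp only [h, true_and, beq_self_eq_true, if_true]; omega
    · simp [h]

/-- Same content and same scattered subwords of length two. -/
def StyQ {X : Type*} (w w' : List X) : Prop :=
  (∀ x, x ∈ w ↔ x ∈ w') ∧ ∀ x z, StyPr x z w ↔ StyPr x z w'

theorem StyQ.symm {X : Type*} {w w' : List X} (h : StyQ w w') : StyQ w' w :=
  ⟨fun x => (h.1 x).symm, fun x z => (h.2 x z).symm⟩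

theorem StyQ.trans {X : Type*} {w w' w'' : List X} (h : StyQ w w') (h' : StyQ w' w'') :
    StyQ w w'' :=
  ⟨fun x => (h.1 x).trans (h'.1 x), fun x z => (h.2 x z).trans (h'.2 x z)⟩

/-- Derivability by a few consequences of the two identities. -/
inductive StyEqv {X : Type*} : List X → List X → Prop
  | refl (w) : StyEqv w w
  | symm {w w'} : StyEqv w w' → StyEqv w' w
  | trans {w w' w''} : StyEqv w w' → StyEqv w' w'' → StyEqv w w''
  | ins (p q r s : List X) (x : X) :
      StyEqv (p ++ x :: (q ++ x :: (r ++ x :: s))) (p ++ x :: (q ++ (r ++ x :: s)))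
  | com1 (p s : List X) (x z : X) : x ∈ s → z ∈ s →
      StyEqv (p ++ z :: x :: s) (p ++ x :: z :: s)
  | com2 (p s : List X) (x z : X) : x ∈ p → z ∈ p →
      StyEqv (p ++ z :: x :: s) (p ++ x :: z :: s)

theorem StyEqv.q {X : Type*} {w w' : List X} (h : StyEqv w w') : StyQ w w' := by
  induction h with
  | refl w => exact ⟨fun _ => Iff.rfl, fun _ _ => Iff.rfl⟩
  | symm _ ih => exact ih.symm
  | trans _ _ ih ih' => exact ih.trans ih'
  | ins p q r s x =>
    refine ⟨fun y => by simp; tauto, fun y z => ?_⟩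
    simp only [styPr_append, StyPr, List.mem_append, List.mem_cons]
    grind
  | com1 p s x z hx hz =>
    refine ⟨fun y => by simp; tauto, fun y t => ?_⟩
    simp only [styPr_append, StyPr, List.mem_append, List.mem_cons]
    grind
  | com2 p s x z hx hz =>
    refine ⟨fun y => by simp; tauto, fun y t => ?_⟩
    simp only [styPr_append, StyPr, List.mem_append, List.mem_cons]
    grind

theorem StyEqv.sound {X : Type*} {w w' : List X} (h : StyEqv w w') {M : Type*} [Monoid M]
    (h1 : ∀ x y z : M, x * y * x * z * x = x * y * z * x)
    (h2 : ∀ x y : M, (x * y) ^ 2 = (y * x) ^ 2) (f : X → M) :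
    (w.map f).prod = (w'.map f).prod := by
  have h2' : ∀ x y : M, x * y * x * y = y * x * y * x := fun x y => by
    simpa [pow_two, mul_assoc] using h2 x y
  induction h with
  | refl w => rfl
  | symm _ ih => exact ih.symm
  | trans _ _ ih ih' => exact ih.trans ih'
  | ins p q r s x =>
    have := h1 (f x) (q.map f).prod (r.map f).prod
    simp only [List.map_append, List.map_cons, List.prod_append, List.prod_cons]
    calc _ = (p.map f).prod * (f x * (q.map f).prod * f x * (r.map f).prod * f x)
              * (s.map f).prod := by simp only [mul_assoc]
      _ = _ := by rw [this]; simp only [mul_assoc]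
  | com1 p s x z hx hz =>
    have key : ∀ y ∈ s, ∀ g, f y * g * f y * (s.map f).prod = f y * g * (s.map f).prod := by
      intro y hy g
      obtain ⟨A, B, rfl⟩ := List.append_of_mem hy
      simp only [List.map_append, List.map_cons, List.prod_append, List.prod_cons]
      have := h1 (f y) g (A.map f).prod
      calc _ = (f y * g * f y * (A.map f).prod * f y) * (B.map f).prod := by
              simp only [mul_assoc]
        _ = _ := by rw [this]; simp only [mul_assoc]
    have key2 : ∀ x ∈ s, ∀ z ∈ s,
        f x * f z * f x * f z * (s.map f).prod = f x * f z * (s.map f).prod := by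
      intro x hx z hz
      have a1 := key x hx (f z)
      have a2 := key z hz (f x)
      calc _ = f x * (f z * f x * f z * (s.map f).prod) := by simp only [mul_assoc]
        _ = f x * f z * f x * (s.map f).prod := by rw [a2]; simp only [mul_assoc]
        _ = _ := a1
    simp only [List.map_append, List.map_cons, List.prod_append, List.prod_cons]
    rw [← mul_assoc (f z), ← key2 z hz x hx, h2', key2 x hx z hz, mul_assoc]
  | com2 s t x z hx hz =>
    have key : ∀ y ∈ s, ∀ g, (s.map f).prod * f y * g * f y = (s.map f).prod * g * f y := by
      intro y hy g
      obtain ⟨A, B, rfl⟩ := List.append_of_mem hy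
      simp only [List.map_append, List.map_cons, List.prod_append, List.prod_cons]
      have := h1 (f y) (B.map f).prod g
      calc _ = (A.map f).prod * (f y * (B.map f).prod * f y * g * f y) := by
              simp only [mul_assoc]
        _ = _ := by rw [this]; simp only [mul_assoc]
    have key2 : ∀ x ∈ s, ∀ z ∈ s,
        (s.map f).prod * (f x * f z * f x * f z) = (s.map f).prod * (f x * f z) := by
      intro x hx z hz
      have a1 := key x hx (f z)
      have a2 := key z hz (f x)
      calc _ = ((s.map f).prod * f x * f z * f x) * f z := by simp only [mul_assoc]
        _ = (s.map f).prod * f z * f x * f z := by rw [a1]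
        _ = _ := by rw [a2, mul_assoc]
    simp only [List.map_append, List.map_cons, List.prod_append, List.prod_cons]
    rw [← mul_assoc (f z), ← mul_assoc _ (f z * f x), ← key2 z hz x hx, h2', key2 x hx z hz]
    simp only [mul_assoc]

theorem sty_reduce {X : Type*} [DecidableEq X] (n : ℕ) : ∀ w : List X, w.length = n →
    ∃ r : List X, StyEqv w r ∧ ∀ x, r.count x ≤ 2 := by
  induction n using Nat.strong_induction_on with
  | _ n ih =>
    intro w hw
    by_cases hc : ∀ x, w.count x ≤ 2
    · exact ⟨w, .refl w, hc⟩
    · push Not at hc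
      obtain ⟨x, hx⟩ := hc
      obtain ⟨p, w1, rfl, hp⟩ := List.eq_append_cons_of_mem
        (List.count_pos_iff.1 (by omega : 0 < w.count x))
      rw [List.count_append, List.count_cons_self, List.count_eq_zero_of_not_mem hp] at hx
      obtain ⟨q, w2, rfl, hq⟩ := List.eq_append_cons_of_mem
        (List.count_pos_iff.1 (by omega : 0 < w1.count x))
      rw [List.count_append, List.count_cons_self, List.count_eq_zero_of_not_mem hq] at hx
      obtain ⟨r, s, rfl, hr⟩ := List.eq_append_cons_of_mem
        (List.count_pos_iff.1 (by omega : 0 < w2.count x))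
      obtain ⟨t, ht, hct⟩ := ih _ (by simp at hw ⊢; omega) (p ++ x :: (q ++ (r ++ x :: s))) rfl
      exact ⟨t, (StyEqv.ins p q r s x).trans ht, hct⟩

theorem sty_move1 {X : Type*} (x : X) (v2 : List X) (hx : x ∈ v2) (v1 : List X) :
    ∀ p : List X, (∀ z ∈ v1, z ∈ v2) → StyEqv (p ++ (v1 ++ x :: v2)) (p ++ x :: (v1 ++ v2)) := by
  induction v1 with
  | nil => intro p _; exact .refl _
  | cons z v1 ih =>
    intro p h
    have := ih (p ++ [z]) (fun y hy => h y (by simp [hy]))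
    simp only [List.append_assoc, List.singleton_append] at this
    exact this.trans (.com1 p (v1 ++ v2) x z (by simp [hx]) (by simp [h z]))

theorem sty_move2 {X : Type*} (x : X) (v2 : List X) (v1 : List X) :
    ∀ p : List X, x ∈ p → (∀ z ∈ v1, z ∈ p) →
      StyEqv (p ++ (v1 ++ x :: v2)) (p ++ x :: (v1 ++ v2)) := by
  induction v1 with
  | nil => intro p _ _; exact .refl _
  | cons z v1 ih =>
    intro p hx h
    have := ih (p ++ [z]) (by simp [hx]) (fun y hy => by simp [h y (by simp [hy])])
    simp only [List.append_assoc, List.singleton_append] at this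
    exact this.trans (.com2 p (v1 ++ v2) x z hx (h z (by simp)))

theorem sty_main {X : Type*} [DecidableEq X] (u : List X) : ∀ p v : List X, u.Perm v →
    (∀ x, (p ++ u).count x ≤ 2) → StyQ (p ++ u) (p ++ v) → StyEqv (p ++ u) (p ++ v) := by
  induction u with
  | nil =>
    intro p v hv _ _
    rw [List.nil_perm.1 hv]
    exact .refl _
  | cons x u ih =>
    intro p v hv hc hq
    obtain ⟨v1, v2, rfl, hx1⟩ := List.eq_append_cons_of_mem (hv.subset (by simp : x ∈ x :: u))
    have hperm : u.Perm (v1 ++ v2) := (List.perm_cons x).1 (hv.trans List.perm_middle)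
    have hmem : ∀ z, z ∈ u ↔ z ∈ v1 ∨ z ∈ v2 := fun z => by rw [hperm.mem_iff, List.mem_append]
    have hcount : ∀ z, u.count z = v1.count z + v2.count z := fun z => by
      rw [hperm.count_eq, List.count_append]
    have hmove : StyEqv (p ++ (v1 ++ x :: v2)) (p ++ x :: (v1 ++ v2)) := by
      have hcx := hc x
      rw [List.count_append, List.count_cons_self] at hcx
      by_cases hxp : x ∈ p
      · have hxu : x ∉ u := by
          intro hxu
          have := List.count_pos_iff.2 hxp
          have := List.count_pos_iff.2 hxu
          omega
        refine sty_move2 x v2 v1 p hxp fun z hz => ?_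
        by_contra hzp
        have hzx : z ≠ x := fun e => hx1 (e ▸ hz)
        have h3 := (hq.2 z x).2 (by
          simp only [styPr_append, StyPr, List.mem_append, List.mem_cons]; tauto)
        simp only [styPr_append, StyPr] at h3
        rcases h3 with h3 | (h3 | h3) | h3
        · exact hzp (styPr_mem h3).1
        · exact hxu h3.2
        · exact hxu (styPr_mem h3).2
        · exact hzp h3.1
      · have hz2 : ∀ z ∈ v1, z ∈ v2 := by
          intro z hz
          have h3 := (hq.2 x z).1 (by
            simp only [styPr_append, StyPr, List.mem_append, List.mem_cons, hmem]; tauto)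
          simp only [styPr_append, StyPr] at h3
          rcases h3 with h3 | (h3 | (h3 | h3) | h3) | h3
          · exact absurd (styPr_mem h3).1 hxp
          · exact absurd (styPr_mem h3).1 hx1
          · exact h3.2
          · exact (styPr_mem h3).2
          · exact absurd h3.1 hx1
          · exact absurd h3.1 hxp
        by_cases hxu : x ∈ u
        · exact sty_move1 x v2 (((hmem x).1 hxu).resolve_left hx1) v1 p hz2
        · cases v1 with
          | nil => exact .refl _
          | cons z v1 =>
            exfalso
            have hzv2 := hz2 z (by simp)
            have hzx : z ≠ x := fun e => hx1 (by simp [e])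
            have h3 := (hq.2 z x).2 (by
              simp only [styPr_append, StyPr, List.mem_append, List.mem_cons]; tauto)
            simp only [styPr_append, StyPr] at h3
            have hzp : z ∈ p := by
              rcases h3 with h3 | (h3 | h3) | h3
              · exact (styPr_mem h3).1
              · exact absurd h3.2 hxu
              · exact absurd (styPr_mem h3).2 hxu
              · exact h3.1
            have h4 := hc z
            rw [List.count_append, List.count_cons, hcount, List.count_cons_self] at h4
            have := List.count_pos_iff.2 hzp
            have := List.count_pos_iff.2 hzv2
            omega
    have h5 := ih (p ++ [x]) (v1 ++ v2) hperm (by simpa using hc)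
      (by simpa using hq.trans hmove.q)
    simp only [List.append_assoc, List.singleton_append] at h5
    exact h5.trans hmove.symm

theorem sty_complete {X : Type*} (w w' : List X) (h : StyQ w w') : StyEqv w w' := by
  classical
  obtain ⟨r, hr, hrc⟩ := sty_reduce _ w rfl
  obtain ⟨r', hr', hrc'⟩ := sty_reduce _ w' rfl
  have hq : StyQ r r' := (hr.q.symm.trans h).trans hr'.q
  have hperm : r.Perm r' := by
    rw [List.perm_iff_count]
    intro x
    have e1 := hq.1 x
    have e2 := hq.2 x x
    rw [← List.count_pos_iff, ← List.count_pos_iff] at e1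
    rw [styPr_self, styPr_self] at e2
    have := hrc x
    have := hrc' x
    omega
  have := sty_main r [] r' hperm (by simpa using hrc) (by simpa using hq)
  exact (hr.trans (by simpa using this)).trans hr'.symm

/-- A concrete five-element model of the stylic monoid of rank two. -/
inductive StyT | e | a | b | ab | z

/-- Multiplication of the concrete model. -/
def StyT.mul : StyT → StyT → StyT
  | .e, y => y
  | x, .e => x
  | .a, .a => .a
  | .a, .b => .ab
  | .a, .ab => .ab
  | .b, .b => .b
  | .ab, .b => .ab
  | _, _ => .z

instance : Monoid StyT where
  mul := StyT.mul
  one := .e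
  mul_assoc := by intro x y t; cases x <;> cases y <;> cases t <;> rfl
  one_mul := by intro x; cases x <;> rfl
  mul_one := by intro x; cases x <;> rfl

/-- The projection from the stylic monoid. -/
def styProj : Styl 2 →* StyT :=
  PresentedMonoid.lift (fun i : Fin 2 => if i = 0 then StyT.a else StyT.b) (by
    rintro u v (⟨i, rfl, rfl⟩ | ⟨i, j, k, hij, hjk, rfl, rfl⟩ | ⟨i, j, k, hij, hjk, rfl, rfl⟩ |
      ⟨i, j, hij, rfl, rfl⟩ | ⟨i, j, hij, rfl, rfl⟩)
    · fin_cases i <;> rfl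
    · omega
    · omega
    · obtain rfl : i = 0 := by omega
      obtain rfl : j = 1 := by omega
      rfl
    · obtain rfl : i = 0 := by omega
      obtain rfl : j = 1 := by omega
      rfl)

theorem styProj_surj : Function.Surjective styProj := by
  intro t
  cases t
  · exact ⟨1, rfl⟩
  · exact ⟨stylGen 2 0, rfl⟩
  · exact ⟨stylGen 2 1, rfl⟩
  · exact ⟨stylGen 2 0 * stylGen 2 1, rfl⟩
  · exact ⟨stylGen 2 1 * stylGen 2 0, rfl⟩

theorem sty_eval_self {X : Type*} [DecidableEq X] (x : X) (l : List X) :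
    ((l.map (fun y => if y = x then StyT.ab else 1)).prod = .e ↔ x ∉ l) ∧
    ((l.map (fun y => if y = x then StyT.ab else 1)).prod = .z ↔ StyPr x x l) ∧
    (l.map (fun y => if y = x then StyT.ab else 1)).prod ≠ .a ∧ (l.map (fun y => if y = x then StyT.ab else 1)).prod ≠ .b := by
  induction l with
  | nil =>
    rw [List.map_nil, List.prod_nil, show (1 : StyT) = .e from rfl]; simp [StyPr]
  | cons y l ih =>
    simp only [List.map_cons, List.prod_cons, StyPr, List.mem_cons]
    have hp := @styPr_mem X x x l
    generalize (l.map (fun y => if y = x then StyT.ab else 1)).prod = t at *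
    by_cases hy : y = x
    · subst hy
      simp only [if_true]
      cases t <;> simp [show ∀ u v : StyT, u * v = StyT.mul u v from fun _ _ => rfl, StyT.mul] at * <;> tauto
    · have hy' : x ≠ y := Ne.symm hy
      simp [hy, hy', ih]

theorem sty_eval_pair {X : Type*} [DecidableEq X] (x z : X) (hxz : x ≠ z) (l : List X) :
    ((l.map (fun y => if y = x then StyT.b else if y = z then StyT.a else 1)).prod = .e ↔
      x ∉ l ∧ z ∉ l) ∧
    ((l.map (fun y => if y = x then StyT.b else if y = z then StyT.a else 1)).prod = .b ↔
      x ∈ l ∧ z ∉ l) ∧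
    ((l.map (fun y => if y = x then StyT.b else if y = z then StyT.a else 1)).prod = .a ↔
      x ∉ l ∧ z ∈ l) ∧
    ((l.map (fun y => if y = x then StyT.b else if y = z then StyT.a else 1)).prod = .z ↔
      StyPr x z l) := by
  induction l with
  | nil =>
    rw [List.map_nil, List.prod_nil, show (1 : StyT) = .e from rfl]; simp [StyPr]
  | cons y l ih =>
    simp only [List.map_cons, List.prod_cons, StyPr, List.mem_cons]
    have hp := @styPr_mem X x z l
    generalize (l.map (fun y => if y = x then StyT.b else if y = z then StyT.a else 1)).prod = t at *
    by_cases hy : y = x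
    · subst hy
      have hxz' := hxz.symm
      simp only [if_true]
      cases t <;> simp [show ∀ u v : StyT, u * v = StyT.mul u v from fun _ _ => rfl, StyT.mul] at * <;> tauto
    · have hy' : x ≠ y := Ne.symm hy
      by_cases hz : y = z
      · subst hz
        simp only [if_neg hy, if_true]
        cases t <;> simp [show ∀ u v : StyT, u * v = StyT.mul u v from fun _ _ => rfl, StyT.mul] at * <;> tauto
      · have hz' : z ≠ y := Ne.symm hz
        simp [hy, hy', hz, hz', ih]

theorem sty_extract {X : Type*} (w w' : List X)
    (h : ∀ f : X → StyT, (w.map f).prod = (w'.map f).prod) : StyQ w w' := by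
  classical
  refine ⟨fun x => ?_, fun x z => ?_⟩
  · rw [← not_iff_not, ← (sty_eval_self x w).1, ← (sty_eval_self x w').1, h]
  · by_cases hxz : x = z
    · subst hxz
      rw [← (sty_eval_self x w).2.1, ← (sty_eval_self x w').2.1, h]
    · rw [← (sty_eval_pair x z hxz w).2.2.2, ← (sty_eval_pair x z hxz w').2.2.2, h]

/-- Every monoid identity `w = w'` (over any alphabet `X`) holding in the stylic monoid
`Styl_2` follows from the identities `xyxzx = xyzx` and `(xy)² = (yx)²`: every monoid
satisfying these two identities also satisfies `w = w'`. -/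
theorem basis_for_identities_of_styl_two (X : Type*) (w w' : FreeMonoid X)
    (h : ∀ φ : FreeMonoid X →* Styl 2, φ w = φ w')
    (M : Type*) [Monoid M]
    (h1 : ∀ x y z : M, x * y * x * z * x = x * y * z * x)
    (h2 : ∀ x y : M, (x * y) ^ 2 = (y * x) ^ 2) :
    ∀ φ : FreeMonoid X →* M, φ w = φ w' := by
  intro φ
  have hq : StyQ w.toList w'.toList := by
    apply sty_extract
    intro f
    choose g hg using fun x => styProj_surj (f x)
    have := congrArg styProj (h (FreeMonoid.lift g))
    rw [FreeMonoid.lift_apply, FreeMonoid.lift_apply, map_list_prod, map_list_prod,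
      List.map_map, List.map_map] at this
    have e : (⇑styProj ∘ g) = f := funext hg
    rwa [e] at this
  have := (sty_complete _ _ hq).sound h1 h2 (fun x => φ (FreeMonoid.of x))
  rw [← FreeMonoid.lift_apply, ← FreeMonoid.lift_apply] at this
  have e : FreeMonoid.lift (fun x => φ (FreeMonoid.of x)) = φ := by
    ext x; simp
  rwa [e] at this
end

section
/- The identities xyx²zx = xyxzx, xyzx²tz = xyxzx²tz, zyx²ztx = zyx²zxtx, and (xy)³ = (yx)³ (over a four-letter alphabet {x, y, z, t}) hold in the stylic monoid Styl_3. -/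
/-- Normal-form words of the 15 elements. -/
def nfWords : List (List (Fin 3)) := [[], [0], [1], [2], [0, 1], [0, 2], [1, 0], [1, 2], [2, 0], [2, 1], [0, 1, 2], [0, 2, 1], [1, 0, 2], [2, 1, 0], [1, 0, 2, 1]]

/-- Evaluation of a word in the stylic monoid. -/
def evalWord (l : List (Fin 3)) : Styl 3 := (l.map (stylGen 3)).prod

/-- The element with normal form number `i`. -/
def nfElem (i : ℕ) : Styl 3 := evalWord (nfWords.getD i [])

/-- The multiplication table (entry `(i, j)` is hexadecimal digit number `16 i + j`). -/
def tbl (i j : ℕ) : ℕ := (527871212063438974923746994540927434791814575189775470884884557001856166738484271727217651553574639486141635100458951212524868695135066822526939914667889777471044257220495235034883923670583325046084865285465395041411919673709800921619328744759525730816946612807659464649472033363286307344 / 16 ^ (16 * i + j)) % 16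

/-- The list of all indices. -/
def idx : List ℕ := [0, 1, 2, 3, 4, 5, 6, 7, 8, 9, 10, 11, 12, 13, 14]

/-- The index of a generator. -/
def gidx (g : Fin 3) : ℕ := g.val + 1

theorem stylGen_rel {u v : FreeMonoid (Fin 3)} (h : stylRel 3 u v) :
    PresentedMonoid.mk (stylRel 3) u = PresentedMonoid.mk (stylRel 3) v :=
  PresentedMonoid.mk_eq_mk_of_rel h

theorem gen_idem (i : Fin 3) : stylGen 3 i * stylGen 3 i = stylGen 3 i :=
  stylGen_rel (Or.inl ⟨i, rfl, rfl⟩)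

theorem gen_knuth1 (i j k : Fin 3) (h : i < j) (h' : j < k) :
    stylGen 3 j * stylGen 3 i * stylGen 3 k = stylGen 3 j * stylGen 3 k * stylGen 3 i :=
  stylGen_rel (Or.inr (Or.inl ⟨i, j, k, h, h', rfl, rfl⟩))

theorem gen_knuth2 (i j k : Fin 3) (h : i < j) (h' : j < k) :
    stylGen 3 i * stylGen 3 k * stylGen 3 j = stylGen 3 k * stylGen 3 i * stylGen 3 j :=
  stylGen_rel (Or.inr (Or.inr (Or.inl ⟨i, j, k, h, h', rfl, rfl⟩)))

theorem gen_pl1 (i j : Fin 3) (h : i < j) :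
    stylGen 3 i * stylGen 3 j * stylGen 3 i = stylGen 3 j * stylGen 3 i := by
  have := stylGen_rel (Or.inr (Or.inr (Or.inr (Or.inl ⟨i, j, h, rfl, rfl⟩))))
  change stylGen 3 j * stylGen 3 i * stylGen 3 i = stylGen 3 i * stylGen 3 j * stylGen 3 i at this
  rw [← this, mul_assoc, gen_idem]

theorem gen_pl2 (i j : Fin 3) (h : i < j) :
    stylGen 3 j * stylGen 3 i * stylGen 3 j = stylGen 3 j * stylGen 3 i := by
  have := stylGen_rel (Or.inr (Or.inr (Or.inr (Or.inr ⟨i, j, h, rfl, rfl⟩))))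
  change stylGen 3 j * stylGen 3 j * stylGen 3 i = stylGen 3 j * stylGen 3 i * stylGen 3 j at this
  rw [← this, gen_idem]

/-- Right multiplication of a normal form by a generator. -/
theorem nfElem_mul_gen (i : ℕ) (hi : i < 15) (g : Fin 3) :
    nfElem i * stylGen 3 g = nfElem (tbl i (gidx g)) := by
  have aa := gen_idem 0
  have bb := gen_idem 1
  have cc := gen_idem 2
  have aba := gen_pl1 0 1 (by decide)
  have aca := gen_pl1 0 2 (by decide)
  have bcb := gen_pl1 1 2 (by decide)
  have bab := gen_pl2 0 1 (by decide)
  have cac := gen_pl2 0 2 (by decide)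
  have cbc := gen_pl2 1 2 (by decide)
  have bca := (gen_knuth1 0 1 2 (by decide) (by decide)).symm
  have cab := (gen_knuth2 0 1 2 (by decide) (by decide)).symm
  have key : nfElem i * stylGen 3 g = evalWord (nfWords.getD i [] ++ [g]) := by
    simp [nfElem, evalWord]
  rw [key, nfElem]
  generalize hk : tbl i (gidx g) = k
  simp only [evalWord]
  have h0 : stylGen 3 = ![stylGen 3 0, stylGen 3 1, stylGen 3 2] := by
    funext j; fin_cases j <;> rfl
  rw [h0]
  generalize stylGen 3 0 = a at *
  generalize stylGen 3 1 = b at *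
  generalize stylGen 3 2 = c at *
  have acba : a * c * b * a = c * b * a := by
    rw [← cab, mul_assoc c a b, mul_assoc c, aba, mul_assoc]
  have cbac : c * b * a * c = c * b * a := by
    rw [mul_assoc c b a, mul_assoc c (b * a) c, ← bca, ← mul_assoc, ← mul_assoc, cbc, mul_assoc]
  clear key h0
  subst hk
  interval_cases i <;> fin_cases g <;>
    simp [nfWords, tbl, gidx, ← mul_assoc, aa, bb, cc, aba, aca, bcb, bab, cac, cbc, bca, cab,
      acba, cbac]

/-- All table entries are indices. -/
theorem tbl_lt : ∀ i ∈ idx, ∀ j ∈ idx, tbl i j ∈ idx := by decide +kernel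

theorem mem_idx {i : ℕ} : i ∈ idx ↔ i < 15 := by
  simp only [idx, List.mem_cons, List.not_mem_nil, or_false]; omega

theorem gidx_mem (g : Fin 3) : gidx g ∈ idx := by
  rw [mem_idx, gidx]; omega

theorem nfElem_mul_word (l : List (Fin 3)) : ∀ i ∈ idx,
    nfElem i * evalWord l = nfElem (l.foldl (fun p g => tbl p (gidx g)) i) ∧
      l.foldl (fun p g => tbl p (gidx g)) i ∈ idx := by
  induction l with
  | nil => intro i hi; simpa [evalWord] using hi
  | cons g l ih =>
    intro i hi
    have h := ih (tbl i (gidx g)) (tbl_lt i hi _ (gidx_mem g))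
    refine ⟨?_, h.2⟩
    rw [List.foldl_cons, ← h.1, ← nfElem_mul_gen i (mem_idx.1 hi) g, mul_assoc]
    simp [evalWord]

theorem tbl_word : ∀ i ∈ idx, ∀ j ∈ idx,
    (nfWords.getD j []).foldl (fun p g => tbl p (gidx g)) i = tbl i j := by decide +kernel

theorem nfElem_mul {i j : ℕ} (hi : i ∈ idx) (hj : j ∈ idx) :
    nfElem i * nfElem j = nfElem (tbl i j) := by
  rw [← tbl_word i hi j hj, ← (nfElem_mul_word _ i hi).1, nfElem, nfElem]

theorem exists_idx (x : Styl 3) : ∃ i ∈ idx, nfElem i = x := by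
  induction x using PresentedMonoid.inductionOn with
  | h w =>
    have h := nfElem_mul_word (FreeMonoid.toList w) 0 (by decide)
    refine ⟨_, h.2, ?_⟩
    rw [← h.1]
    have h1 : nfElem 0 = 1 := by simp [nfElem, nfWords, evalWord]
    rw [h1, one_mul]
    clear h
    induction w using FreeMonoid.inductionOn' with
    | one => simp [evalWord]
    | of_mul g w ih =>
      rw [(PresentedMonoid.mk (stylRel 3)).map_mul, ← ih]
      simp [evalWord]
      rfl

theorem check1 : ∀ x ∈ idx, ∀ y ∈ idx, ∀ z ∈ idx,
    tbl (tbl (tbl (tbl (tbl x y) x) x) z) x = tbl (tbl (tbl (tbl x y) x) z) x := by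
  decide +kernel

theorem check2 : ∀ x ∈ idx, ∀ y ∈ idx, ∀ z ∈ idx,
    tbl (tbl (tbl (tbl x y) z) x) x = tbl (tbl (tbl (tbl (tbl x y) x) z) x) x ∨ ∀ t ∈ idx,
    tbl (tbl (tbl (tbl (tbl (tbl x y) z) x) x) t) z =
      tbl (tbl (tbl (tbl (tbl (tbl (tbl x y) x) z) x) x) t) z := by
  decide +kernel

theorem check3 : ∀ x ∈ idx, ∀ y ∈ idx, ∀ z ∈ idx,
    tbl (tbl (tbl (tbl z y) x) x) z = tbl (tbl (tbl (tbl (tbl z y) x) x) z) x ∨ ∀ t ∈ idx,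
    tbl (tbl (tbl (tbl (tbl (tbl z y) x) x) z) t) x =
      tbl (tbl (tbl (tbl (tbl (tbl (tbl z y) x) x) z) x) t) x := by
  decide +kernel

theorem check4 : ∀ x ∈ idx, ∀ y ∈ idx,
    tbl (tbl (tbl (tbl (tbl x y) x) y) x) y = tbl (tbl (tbl (tbl (tbl y x) y) x) y) x := by
  decide +kernel

/-- The identities `xyx²zx = xyxzx`, `xyzx²tz = xyxzx²tz`, `zyx²ztx = zyx²zxtx` and
`(xy)³ = (yx)³` hold in the stylic monoid `Styl_3`. -/
theorem styl_three_satisfies_basis_identities :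
    (∀ x y z : Styl 3, x * y * x ^ 2 * z * x = x * y * x * z * x) ∧
    (∀ x y z t : Styl 3, x * y * z * x ^ 2 * t * z = x * y * x * z * x ^ 2 * t * z) ∧
    (∀ x y z t : Styl 3, z * y * x ^ 2 * z * t * x = z * y * x ^ 2 * z * x * t * x) ∧
    (∀ x y : Styl 3, (x * y) ^ 3 = (y * x) ^ 3) := by
  refine ⟨?_, ?_, ?_, ?_⟩
  · intro x y z
    obtain ⟨x, hx, rfl⟩ := exists_idx x
    obtain ⟨y, hy, rfl⟩ := exists_idx y
    obtain ⟨z, hz, rfl⟩ := exists_idx z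
    have h := check1 x hx y hy z hz
    simp only [pow_two, ← mul_assoc]
    simp (maxDischargeDepth := 20) only [nfElem_mul, hx, hy, hz, tbl_lt, h]
  · intro x y z t
    obtain ⟨x, hx, rfl⟩ := exists_idx x
    obtain ⟨y, hy, rfl⟩ := exists_idx y
    obtain ⟨z, hz, rfl⟩ := exists_idx z
    obtain ⟨t, ht, rfl⟩ := exists_idx t
    have h := check2 x hx y hy z hz
    simp only [pow_two, ← mul_assoc]
    simp (maxDischargeDepth := 20) only [nfElem_mul, hx, hy, hz, ht, tbl_lt]
    rcases h with h | h
    · rw [h]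
    · rw [h t ht]
  · intro x y z t
    obtain ⟨x, hx, rfl⟩ := exists_idx x
    obtain ⟨y, hy, rfl⟩ := exists_idx y
    obtain ⟨z, hz, rfl⟩ := exists_idx z
    obtain ⟨t, ht, rfl⟩ := exists_idx t
    have h := check3 x hx y hy z hz
    simp only [pow_two, ← mul_assoc]
    simp (maxDischargeDepth := 20) only [nfElem_mul, hx, hy, hz, ht, tbl_lt]
    rcases h with h | h
    · rw [← h]
    · rw [h t ht]
  · intro x y
    obtain ⟨x, hx, rfl⟩ := exists_idx x
    obtain ⟨y, hy, rfl⟩ := exists_idx y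
    have h := check4 x hx y hy
    simp only [pow_succ, pow_zero, one_mul, ← mul_assoc]
    simp (maxDischargeDepth := 20) only [nfElem_mul, hx, hy, tbl_lt, h]
end

section
/- Every monoid identity w = w' (over any alphabet X) that holds in the stylic monoid Styl_3 follows from the four identities xyx²zx = xyxzx, xyzx²tz = xyxzx²tz, zyx²ztx = zyx²zxtx, and (xy)³ = (yx)³; that is, every monoid satisfying these four identities also satisfies w = w'. -/
namespace StylAux

/-- The four identities. -/
structure Ids (M : Type*) [Monoid M] : Prop where
  h1 : ∀ x y z : M, x * y * x ^ 2 * z * x = x * y * x * z * x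
  h2 : ∀ x y z t : M, x * y * z * x ^ 2 * t * z = x * y * x * z * x ^ 2 * t * z
  h3 : ∀ x y z t : M, z * y * x ^ 2 * z * t * x = z * y * x ^ 2 * z * x * t * x
  h4 : ∀ x y : M, (x * y) ^ 3 = (y * x) ^ 3

theorem Ids.op {M : Type*} [Monoid M] (H : Ids M) : Ids Mᵐᵒᵖ := by
  constructor
  · intro x y z
    apply MulOpposite.unop_injective
    simpa [mul_assoc] using H.h1 x.unop z.unop y.unop
  · intro x y z t
    apply MulOpposite.unop_injective
    simpa [mul_assoc] using H.h3 x.unop t.unop z.unop y.unop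
  · intro x y z t
    apply MulOpposite.unop_injective
    simpa [mul_assoc] using H.h2 x.unop t.unop z.unop y.unop
  · intro x y
    apply MulOpposite.unop_injective
    simpa [mul_assoc] using H.h4 y.unop x.unop

variable {X : Type*}

/-- Evaluation of a word. -/
def ev {M : Type*} [Monoid M] (f : X → M) (w : List X) : M := (w.map f).prod

section
variable {M : Type*} [Monoid M] (f : X → M)

@[simp] theorem ev_nil : ev f [] = 1 := by simp [ev]
@[simp] theorem ev_cons (a : X) (w : List X) : ev f (a :: w) = f a * ev f w := by simp [ev]
@[simp] theorem ev_append (u v : List X) : ev f (u ++ v) = ev f u * ev f v := by simp [ev]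

theorem ev_op (w : List X) :
    ev (fun x => MulOpposite.op (f x)) w.reverse = MulOpposite.op (ev f w) := by
  induction w with
  | nil => simp
  | cons a w ih => simp [ih]

theorem key (H : Ids M) (a : X) (r : List X) : ∀ (p : List X) (t : M),
    a ∈ p → (∀ c ∈ r, c ∈ p) →
    ev f p * (f a) ^ 2 * ev f r * t * f a = ev f p * (f a) ^ 2 * ev f r * f a * t * f a := by
  induction r with
  | nil =>
    intro p t hp _
    obtain ⟨p1, p2, rfl⟩ := List.append_of_mem hp
    have e1 := H.h1 (f a) (ev f p2) t
    have e2 := H.h1 (f a) (ev f p2) (f a * t)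
    simp only [ev_append, ev_cons, ev_nil, mul_one]
    simp only [pow_two, mul_assoc] at *
    rw [e1, e2, e1]
  | cons z r ih =>
    intro p t hp hr
    obtain ⟨p1, p2, hz⟩ := List.append_of_mem (hr z (by simp))
    obtain ⟨q1, q2, ha⟩ := List.append_of_mem hp
    -- step A: insertion of `a` after `z`
    have A : ∀ s : M, ev f p * (f a) ^ 2 * f z * s * f a
        = ev f p * (f a) ^ 2 * f z * f a * s * f a := by
      intro s
      have := H.h3 (f a) (ev f p2) (f z) s
      rw [hz]
      simp only [ev_append, ev_cons, mul_assoc] at *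
      rw [this]
    -- step B: squaring
    have B : ∀ m s : M, ev f p * m * (f a) ^ 2 * s * f a = ev f p * m * f a * s * f a := by
      intro m s
      have := H.h1 (f a) (ev f q2 * m) s
      rw [ha]
      simp only [ev_append, ev_cons, mul_assoc] at *
      rw [this]
    have I := ih (p ++ [a, a, z]) t (by simp [hp]) (fun c hc => by simp [hr c (by simp [hc])])
    have A1 := A (ev f r * t)
    have A2 := A (ev f r * f a * t)
    have B1 := B ((f a) ^ 2 * f z) (ev f r * t)
    have B2 := B ((f a) ^ 2 * f z) (ev f r * f a * t)
    simp only [ev_append, ev_cons, ev_nil, pow_two, mul_one, mul_assoc] at *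
    rw [A1, ← B1, I, B2, ← A2]

end

/-- `u ~_k u a`. -/
def P (k : ℕ) (u : List X) (a : X) : Prop :=
  ∀ x : List X, x.length < k → x.Sublist u → (x ++ [a]).Sublist u

/-- `v ~_k a v`. -/
def Q (k : ℕ) (v : List X) (a : X) : Prop :=
  ∀ x : List X, x.length < k → x.Sublist v → (a :: x).Sublist v

theorem Q_rev {k : ℕ} {v : List X} {a : X} (h : Q k v a) : P k v.reverse a := by
  intro x hx hs
  have := h x.reverse (by simpa using hx) (by simpa using hs.reverse)
  simpa using this.reverse

theorem split_sub {x y u v : List X} {a : X} (h : (x ++ a :: y).Sublist (u ++ v)) :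
    (x ++ [a]).Sublist u ∨ (a :: y).Sublist v := by
  obtain ⟨l1, l2, e, h1, h2⟩ := List.sublist_append_iff.1 h
  rcases List.append_eq_append_iff.1 e with ⟨s, hs, ht⟩ | ⟨s, hs, ht⟩
  · cases s with
    | nil => right; simp at ht; rw [ht]; exact h2
    | cons b s =>
      simp at ht
      left
      obtain ⟨rfl, _⟩ := ht
      refine List.Sublist.trans ?_ h1
      rw [hs]; simp
  · right
    refine List.Sublist.trans ?_ h2
    rw [ht]; simp

theorem last_occ {a : X} {u : List X} (h : a ∈ u) : ∃ p r, u = p ++ a :: r ∧ a ∉ r := by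
  classical
  obtain ⟨s, t, h1, h2⟩ := List.eq_append_cons_of_mem (List.mem_reverse.2 h)
  refine ⟨t.reverse, s.reverse, ?_, by simpa using h2⟩
  have := congrArg List.reverse h1
  simpa using this

theorem P_mem {k : ℕ} {u : List X} {a : X} (h : P (k+1) u a) : a ∈ u := by
  have := h [] (by simp) (by simp)
  simpa using this

theorem P_split {k : ℕ} {p r : List X} {a : X} (h : P (k+1) (p ++ a :: r) a) (ha : a ∉ r) :
    ∀ c ∈ a :: r, P k p c := by
  intro c hc x hx hs
  have h0 : (x ++ [c]).Sublist (p ++ a :: r) :=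
    hs.append (List.singleton_sublist.2 hc)
  have h1 := h (x ++ [c]) (by simpa using hx) h0
  rw [show p ++ a :: r = (p ++ [a]) ++ r by simp] at h1
  have h1' : ((x ++ [c]) ++ a :: []).Sublist ((p ++ [a]) ++ r) := h1
  rcases split_sub h1' with h2 | h2
  · exact (List.append_sublist_append_right [a]).1 h2
  · exact absurd (h2.subset (by simp)) ha

section
variable {M : Type*} [Monoid M] (f : X → M)

theorem L21 (H : Ids M) {u v : List X} {a : X} (hu : P 2 u a) (hv : a ∈ v) :
    ev f (u ++ a :: v) = ev f (u ++ v) := by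
  obtain ⟨p, r, rfl, har⟩ := last_occ (P_mem hu)
  have hp := P_split hu har
  obtain ⟨t, v2, rfl⟩ := List.append_of_mem hv
  have hap : a ∈ p := P_mem (hp a (by simp))
  have K := key f H a r p (ev f t) hap (fun c hc => P_mem (hp c (by simp [hc])))
  obtain ⟨q1, q2, ha⟩ := List.append_of_mem hap
  have B : ∀ s : M, ev f p * (f a) ^ 2 * s * f a = ev f p * f a * s * f a := by
    intro s
    have := H.h1 (f a) (ev f q2) s
    rw [ha]
    simp only [ev_append, ev_cons, mul_assoc] at *
    rw [this]
  have B1 := B (ev f r * ev f t)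
  have B2 := B (ev f r * f a * ev f t)
  have F : ev f p * f a * ev f r * f a * ev f t * f a = ev f p * f a * ev f r * ev f t * f a := by
    simp only [mul_assoc] at *
    rw [← B1, ← B2, K]
  have F2 := congrArg (· * ev f v2) F
  simpa [mul_assoc] using F2

theorem abs (H : Ids M) (x y : M) : (x * y) ^ 3 * x = (x * y) ^ 3 := by
  have q : ∀ z : M, z ^ 4 = z ^ 3 := by
    intro z
    have := H.h1 z 1 1
    simpa [pow_succ, mul_assoc] using this
  have c : (x * y) ^ 3 * x = x * (x * y) ^ 3 := by
    conv_rhs => rw [H.h4]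
    simp [pow_succ, mul_assoc]
  have d : x * (x * y) ^ 3 * y = (x * y) ^ 3 := by
    rw [← c, mul_assoc, ← pow_succ, q]
  have e : x ^ 3 * (x * y) ^ 3 * y ^ 3 = (x * y) ^ 3 := by
    calc x ^ 3 * (x * y) ^ 3 * y ^ 3
        = x * (x * (x * (x * y) ^ 3 * y) * y) * y := by simp [pow_succ, mul_assoc]
      _ = _ := by rw [d, d, d]
  rw [c]
  calc x * (x * y) ^ 3 = x * (x ^ 3 * (x * y) ^ 3 * y ^ 3) := by rw [e]
    _ = x ^ 4 * (x * y) ^ 3 * y ^ 3 := by rw [pow_succ' x 3]; simp [mul_assoc]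
    _ = _ := by rw [q, e]

theorem ins_many (H : Ids M) (p s : List X) (hp : ∀ c ∈ s, P 2 p c) (W : List X) :
    (∀ c ∈ W, c ∈ s) → ev f (p ++ W ++ s) = ev f (p ++ s) := by
  induction W using List.reverseRecOn with
  | nil => simp
  | append_singleton W b ih =>
    intro hW
    have hb : b ∈ s := hW b (by simp)
    have hW' : ∀ c ∈ W, c ∈ s := fun c hc => hW c (by simp [hc])
    rw [← ih hW']
    have hP : P 2 (p ++ W) b := by
      intro x hx hs
      have : x.Sublist p := by
        match x, hx, hs with
        | [], _, _ => simp
        | [c], _, hs =>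
          rw [List.singleton_sublist] at hs ⊢
          rcases List.mem_append.1 hs with h | h
          · exact h
          · exact P_mem (hp c (hW' c h))
        | _ :: _ :: _, hx, _ => simp at hx
      exact (hp b hb x hx this).trans (List.sublist_append_left _ _)
    have := L21 f H hP hb
    simpa using this

theorem L30 (H : Ids M) {u : List X} {a : X} (hu : P 3 u a) :
    ev f (u ++ [a]) = ev f u := by
  obtain ⟨p, r, rfl, har⟩ := last_occ (P_mem hu)
  have hp := P_split hu har
  have K := ins_many f H p (a :: r) hp (a :: r ++ a :: r)
    (fun c hc => by rcases List.mem_append.1 hc with h | h <;> exact h)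
  have E := abs H (f a) (ev f r)
  have K2 : ev f (p ++ a :: r) = ev f p * (f a * ev f r) ^ 3 := by
    rw [← K]; simp [pow_succ, mul_assoc]
  rw [ev_append, K2, mul_assoc]
  simp [E]

theorem ins (H : Ids M) {u v : List X} {a : X}
    (h : ∀ x : List X, x.length ≤ 3 → x.Sublist (u ++ a :: v) → x.Sublist (u ++ v)) :
    ev f (u ++ a :: v) = ev f (u ++ v) := by
  have cl : ∀ x y : List X, x.length + y.length ≤ 2 → x.Sublist u → y.Sublist v →
      (x ++ [a]).Sublist u ∨ (a :: y).Sublist v := by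
    intro x y hl hx hy
    apply split_sub
    apply h
    · simp; omega
    · exact hx.append (hy.cons_cons a)
  have PQ : ∀ k l : ℕ, k + l = 2 → P (k+1) u a ∨ Q (l+1) v a := by
    intro k l hkl
    by_contra! hc
    obtain ⟨hc1, hc2⟩ := hc
    simp only [P, Q, not_forall] at hc1 hc2
    obtain ⟨x, hx1, hx2, hx3⟩ := hc1
    obtain ⟨y, hy1, hy2, hy3⟩ := hc2
    rcases cl x y (by omega) hx2 hy2 with h | h
    · exact hx3 h
    · exact hy3 h
  have L12 : ∀ {u v : List X}, Q 2 v a → a ∈ u → ev f (u ++ a :: v) = ev f (u ++ v) := by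
    intro u v hq hm
    apply MulOpposite.op_injective
    rw [← ev_op, ← ev_op]
    have := L21 (fun x => MulOpposite.op (f x)) H.op (Q_rev hq) (List.mem_reverse.2 hm)
    simpa using this
  have L03 : ∀ {v : List X}, Q 3 v a → ev f (a :: v) = ev f v := by
    intro v hq
    apply MulOpposite.op_injective
    rw [← ev_op, ← ev_op]
    have := L30 (fun x => MulOpposite.op (f x)) H.op (Q_rev hq)
    simpa using this
  rcases PQ 2 0 rfl with h3 | q1
  · have := L30 f H h3
    rw [show u ++ a :: v = (u ++ [a]) ++ v by simp, ev_append, this, ev_append]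
  rcases PQ 1 1 rfl with h2 | q2
  · exact L21 f H h2 (by simpa using q1 [] (by simp) (by simp))
  rcases PQ 0 2 rfl with h1 | q3
  · exact L12 q2 (P_mem h1)
  · rw [ev_append, L03 q3, ev_append]

/-- Simon congruence of order three. -/
def S (u v : List X) : Prop := ∀ x : List X, x.length ≤ 3 → (x.Sublist u ↔ x.Sublist v)

theorem S.symm {u v : List X} (h : S u v) : S v u := fun x hx => (h x hx).symm

theorem split_not {x z p q : List X} {b : X} (h : (x ++ b :: z).Sublist (p ++ q))
    (hn : ¬ (x ++ [b]).Sublist p) : (b :: z).Sublist q :=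
  (split_sub h).resolve_left hn

/-- If inserting `b` before `a` changes things, we get a witness. -/
theorem witness {p u' : List X} {a b : X}
    (hc : ¬ ∀ x : List X, x.length ≤ 3 → x.Sublist (p ++ b :: a :: u') →
      x.Sublist (p ++ a :: u')) :
    ∃ x z : List X, x.length + z.length ≤ 2 ∧ x.Sublist p ∧ ¬ (x ++ [b]).Sublist p ∧
      z.Sublist (a :: u') ∧ ¬ (x ++ b :: z).Sublist (p ++ a :: u') := by
  simp only [not_forall] at hc
  obtain ⟨w, hw, hs, hn⟩ := hc
  obtain ⟨l1, l2, rfl, h1, h2⟩ := List.sublist_append_iff.1 hs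
  cases h2 with
  | cons _ h => exact absurd (h1.append h) hn
  | cons_cons _ h =>
    rename_i z
    refine ⟨l1, z, by simp at hw; omega, h1, ?_, h, hn⟩
    intro hx
    apply hn
    rw [show l1 ++ b :: z = (l1 ++ [b]) ++ z by simp]
    exact hx.append h

theorem simon_aux {p u' v' x z x' : List X} {a b : X} (hab : a ≠ b)
    (h : S (p ++ a :: u') (p ++ b :: v'))
    (hx' : x'.Sublist p) (hx'n : ¬ (x' ++ [b]).Sublist p)
    (hz : z.Sublist (b :: v'))
    (hn : ¬ (x ++ a :: z).Sublist (p ++ b :: v')) (hx : x.Sublist p)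
    (hl : x.length + z.length ≤ 2)
    (hl2 : x'.length + z.length ≤ 2) : False := by
  have hzu : ¬ z.Sublist u' := by
    intro hzu
    apply hn
    rw [← h _ (by simp; omega)]
    exact hx.append (hzu.cons_cons a)
  have strip : ∀ y : List X, (b :: y).Sublist (a :: u') → (b :: y).Sublist u' := by
    intro y hy
    cases hy with
    | cons _ h => exact h
    | cons_cons _ h => exact absurd rfl hab
  cases hz with
  | cons _ hz =>
    have h1 : (x' ++ b :: z).Sublist (p ++ b :: v') := hx'.append (hz.cons_cons b)
    rw [← h _ (by simp; omega)] at h1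
    exact hzu ((List.sublist_cons_self b z).trans (strip _ (split_not h1 hx'n)))
  | cons_cons _ hz =>
    rename_i z1
    have h1 : (x' ++ b :: z1).Sublist (p ++ b :: v') := hx'.append (hz.cons_cons b)
    rw [← h _ (by simp at hl2 ⊢; omega)] at h1
    exact hzu (strip _ (split_not h1 hx'n))

theorem simon {p u' v' : List X} {a b : X} (hab : a ≠ b)
    (h : S (p ++ a :: u') (p ++ b :: v')) :
    (∀ x : List X, x.length ≤ 3 → x.Sublist (p ++ b :: a :: u') → x.Sublist (p ++ a :: u')) ∨
    (∀ x : List X, x.length ≤ 3 → x.Sublist (p ++ a :: b :: v') → x.Sublist (p ++ b :: v')) := by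
  by_contra hc
  rw [not_or] at hc
  obtain ⟨x', z', hl', hx', hxn', hz', hn'⟩ := witness hc.1
  obtain ⟨x, z, hl, hx, hxn, hz, hn⟩ := witness hc.2
  by_cases hcase : x'.length + z.length ≤ 2
  · exact simon_aux hab h hx' hxn' hz hn hx hl hcase
  · exact simon_aux hab.symm h.symm hx hxn hz' hn' hx' hl' (by omega)

theorem pref (H : Ids M) (p v : List X) (h : S p (p ++ v)) : ev f p = ev f (p ++ v) := by
  induction v with
  | nil => simp
  | cons b v ih =>
    have hsub : (p ++ v).Sublist (p ++ b :: v) :=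
      (List.Sublist.refl p).append (List.sublist_cons_self b v)
    have h2 : S p (p ++ v) := fun x hx =>
      ⟨fun hs => hs.trans (List.sublist_append_left _ _), fun hs => (h x hx).2 (hs.trans hsub)⟩
    rw [ih h2, ins f H]
    intro x hx hs
    exact (h2 x hx).1 ((h x hx).2 hs)

theorem S_ins {p u' v : List X} {a b : X} (h : S (p ++ a :: u') v)
    (h2 : ∀ x : List X, x.length ≤ 3 → x.Sublist (p ++ b :: a :: u') → x.Sublist (p ++ a :: u')) :
    S (p ++ b :: a :: u') v := fun x hx =>
  ⟨fun hs => (h x hx).1 (h2 x hx hs), fun hs => ((h x hx).2 hs).trans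
    ((List.Sublist.refl p).append (List.sublist_cons_self b _))⟩

theorem main (H : Ids M) : ∀ (n : ℕ) (p u v : List X), u.length + v.length ≤ n →
    S (p ++ u) (p ++ v) → ev f (p ++ u) = ev f (p ++ v) := by
  intro n
  induction n with
  | zero =>
    intro p u v hl _
    have hu : u = [] := List.length_eq_zero_iff.1 (by omega)
    have hv : v = [] := List.length_eq_zero_iff.1 (by omega)
    rw [hu, hv]
  | succ n ih =>
    intro p u v hl h
    match u, v, hl, h with
    | [], v, _, h => simpa using pref f H p v (by simpa using h)
    | u, [], _, h => simpa using (pref f H p u (by simpa using h.symm)).symm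
    | a :: u, b :: v, hl, h =>
      simp at hl
      by_cases hab : a = b
      · subst hab
        have := ih (p ++ [a]) u v (by omega) (by simpa using h)
        simpa using this
      · rcases simon hab h with h2 | h2
        · have h3 := S_ins h h2
          rw [← ins f H h2]
          have := ih (p ++ [b]) (a :: u) v (by simp; omega) (by simpa using h3)
          simpa using this
        · have h3 := (S_ins h.symm h2).symm
          rw [← ins f H h2]
          have := ih (p ++ [a]) u (b :: v) (by simp; omega) (by simpa using h3)
          simpa using this

end

/-! The automaton representation of `Styl 3`. -/

/-- The transition `a_{i}` moves state `2 - i` to the next one. -/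
def step (i : Fin 3) (s : Fin 4) : Fin 4 :=
  if s.val + i.val = 2 then s + 1 else s

/-- The same transition as an endomorphism. -/
def stepE (i : Fin 3) : Function.End (Fin 4) := step i

/-- Automaton homomorphism on the free monoid. -/
def autF : FreeMonoid (Fin 3) →* (Function.End (Fin 4))ᵐᵒᵖ :=
  FreeMonoid.lift (fun i => MulOpposite.op (stepE i))

theorem aut_rel : ∀ u v, stylRel 3 u v → autF u = autF v := by
  have e1 : ∀ i : Fin 3, ∀ s, step i (step i s) = step i s := by decide
  have e2 : ∀ i j k : Fin 3, i < j → j < k → ∀ s,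
    step k (step i (step j s)) = step i (step k (step j s)) := by decide
  have e3 : ∀ i j k : Fin 3, i < j → j < k → ∀ s,
    step j (step k (step i s)) = step j (step i (step k s)) := by decide
  have e4 : ∀ i j : Fin 3, i < j → ∀ s,
    step i (step i (step j s)) = step i (step j (step i s)) := by decide
  have e5 : ∀ i j : Fin 3, i < j → ∀ s,
    step i (step j (step j s)) = step j (step i (step j s)) := by decide
  rintro u v (⟨i, rfl, rfl⟩ | ⟨i, j, k, hij, hjk, rfl, rfl⟩ | ⟨i, j, k, hij, hjk, rfl, rfl⟩ |
    ⟨i, j, hij, rfl, rfl⟩ | ⟨i, j, hij, rfl, rfl⟩) <;>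
  simp only [autF, map_mul, FreeMonoid.lift_eval_of] <;>
  apply MulOpposite.unop_injective <;> funext s
  · exact e1 i s
  · exact e2 i j k hij hjk s
  · exact e3 i j k hij hjk s
  · exact e4 i j hij s
  · exact e5 i j hij s

/-- The automaton homomorphism. -/
def aut : Styl 3 →* (Function.End (Fin 4))ᵐᵒᵖ := PresentedMonoid.lift (fun i => MulOpposite.op (stepE i))
  (fun u v h => aut_rel u v h)

open Classical in
/-- The substitution detecting the pattern `c 0, c 1, c 2`. -/
noncomputable def sub (c : Fin 3 → Option X) (x : X) : Styl 3 :=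
  (if c 2 = some x then stylGen 3 0 else 1) * (if c 1 = some x then stylGen 3 1 else 1) *
    (if c 0 = some x then stylGen 3 2 else 1)

open Classical in
/-- Induced transition. -/
noncomputable def tr (c : Fin 3 → Option X) (x : X) (s : Fin 4) : Fin 4 :=
  match s with
  | 0 => if c 0 = some x then 1 else 0
  | 1 => if c 1 = some x then 2 else 1
  | 2 => if c 2 = some x then 3 else 2
  | 3 => 3

theorem aut_gen (i : Fin 3) : aut (stylGen 3 i) = MulOpposite.op (stepE i) := by
  exact PresentedMonoid.lift_of _ _

theorem aut_sub (c : Fin 3 → Option X) (x : X) (s : Fin 4) :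
    (aut (sub c x)).unop s = tr c x s := by
  have e : ∀ (g h k : Function.End (Fin 4)) (s), (g * h * k) s = g (h (k s)) := fun _ _ _ _ => rfl
  simp only [sub, map_mul, apply_ite aut, aut_gen, map_one, MulOpposite.unop_mul,
    ← mul_assoc, e, apply_ite MulOpposite.unop, MulOpposite.unop_op, MulOpposite.unop_one]
  have so : ∀ i s, stepE i s = step i s := fun _ _ => rfl
  have o : ∀ s, (1 : Function.End (Fin 4)) s = s := fun _ => rfl
  by_cases h0 : c 0 = some x <;> by_cases h1 : c 1 = some x <;> by_cases h2 : c 2 = some x <;>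
    simp only [h0, h1, h2, if_true, if_false, o, so, tr] <;> revert s <;> decide

/-- Run of the automaton. -/
noncomputable def run (c : Fin 3 → Option X) (w : List X) (s : Fin 4) : Fin 4 :=
  w.foldl (fun s x => tr c x s) s

theorem run_eq (c : Fin 3 → Option X) (w : FreeMonoid X) : ∀ (s : Fin 4),
    (aut (FreeMonoid.lift (sub c) w)).unop s = run c w.toList s := by
  induction w using FreeMonoid.inductionOn' with
  | one => intro s; simp [run]; rfl
  | of_mul x w ih =>
    intro s
    rw [map_mul, map_mul, FreeMonoid.lift_eval_of, MulOpposite.unop_mul]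
    change (aut (FreeMonoid.lift (sub c) w)).unop ((aut (sub c x)).unop s) = _
    rw [aut_sub, ih]
    rfl

theorem run3 (c : Fin 3 → Option X) (w : List X) : run c w 3 = 3 := by
  induction w with
  | nil => rfl
  | cons x w ih => exact ih

open Classical in
theorem run_step {c : Fin 3 → Option X} {s s' : Fin 4} {y : X} {l : List X}
    (ht : ∀ x, tr c x s = if y = x then s' else s) (hne : s ≠ 3)
    (h : ∀ w, run c w s' = 3 ↔ l.Sublist w) (w : List X) :
    run c w s = 3 ↔ (y :: l).Sublist w := by
  induction w with
  | nil => simpa [run] using hne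
  | cons x w ih =>
    have e : run c (x :: w) s = run c w (tr c x s) := rfl
    rw [e, ht]
    by_cases hy : y = x
    · subst hy
      simp [h]
    · rw [if_neg hy, ih]
      constructor
      · exact fun h => h.cons x
      · intro h
        cases h with
        | cons _ h => exact h
        | cons_cons _ h => exact absurd rfl hy

open Classical in
theorem trl {o : Option X} {y x : X} {s s' : Fin 4} (h : o = some y) :
    (if o = some x then s' else s) = if y = x then s' else s := by
  subst h
  by_cases h : y = x <;> simp [h]

theorem detect {w w' : FreeMonoid X} (h : ∀ φ : FreeMonoid X →* Styl 3, φ w = φ w') :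
    S w.toList w'.toList := by
  have R : ∀ c s, run c w.toList s = run c w'.toList s := by
    intro c s
    rw [← run_eq, ← run_eq, h]
  have b3 : ∀ (c : Fin 3 → Option X) (w : List X), run c w 3 = 3 ↔ ([] : List X).Sublist w := by
    intro c w; simp [run3]
  have b2 : ∀ (c : Fin 3 → Option X) (y : X), c 2 = some y → ∀ w : List X,
      run c w 2 = 3 ↔ [y].Sublist w := fun c y hy =>
    run_step (s := 2) (s' := 3) (fun _ => trl hy) (by decide) (b3 c)
  have b1 : ∀ (c : Fin 3 → Option X) (y z : X), c 1 = some y → c 2 = some z → ∀ w : List X,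
      run c w 1 = 3 ↔ [y, z].Sublist w := fun c y z hy hz =>
    run_step (s := 1) (s' := 2) (fun _ => trl hy) (by decide) (b2 c z hz)
  have b0 : ∀ (c : Fin 3 → Option X) (x y z : X), c 0 = some x → c 1 = some y → c 2 = some z →
      ∀ w : List X, run c w 0 = 3 ↔ [x, y, z].Sublist w := fun c x y z hx hy hz =>
    run_step (s := 0) (s' := 1) (fun _ => trl hx) (by decide) (b1 c y z hy hz)
  intro x hx
  match x, hx with
  | [], _ => simp
  | [x], _ =>
    rw [← b2 (fun _ => some x) x rfl, ← b2 (fun _ => some x) x rfl, R]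
  | [x, y], _ =>
    rw [← b1 ![none, some x, some y] x y rfl rfl, ← b1 ![none, some x, some y] x y rfl rfl, R]
  | [x, y, z], _ =>
    rw [← b0 ![some x, some y, some z] x y z rfl rfl rfl,
      ← b0 ![some x, some y, some z] x y z rfl rfl rfl, R]
  | _ :: _ :: _ :: _ :: _, hx => simp at hx; omega

end StylAux

/-- Every monoid identity `w = w'` (over any alphabet `X`) holding in the stylic monoid
`Styl_3` follows from the identities `xyx²zx = xyxzx`, `xyzx²tz = xyxzx²tz`,
`zyx²ztx = zyx²zxtx` and `(xy)³ = (yx)³`: every monoid satisfying these four identities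
also satisfies `w = w'`. -/
theorem basis_for_identities_of_styl_three (X : Type*) (w w' : FreeMonoid X)
    (h : ∀ φ : FreeMonoid X →* Styl 3, φ w = φ w')
    (M : Type*) [Monoid M]
    (h1 : ∀ x y z : M, x * y * x ^ 2 * z * x = x * y * x * z * x)
    (h2 : ∀ x y z t : M, x * y * z * x ^ 2 * t * z = x * y * x * z * x ^ 2 * t * z)
    (h3 : ∀ x y z t : M, z * y * x ^ 2 * z * t * x = z * y * x ^ 2 * z * x * t * x)
    (h4 : ∀ x y : M, (x * y) ^ 3 = (y * x) ^ 3) :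
    ∀ φ : FreeMonoid X →* M, φ w = φ w' := by
  intro φ
  have E : ∀ u : FreeMonoid X, φ u = StylAux.ev (fun x => φ (FreeMonoid.of x)) u.toList := by
    intro u
    induction u using FreeMonoid.inductionOn' with
    | one => simp
    | of_mul x u ih => rw [map_mul, ih]; simp
  rw [E, E]
  exact StylAux.main _ ⟨h1, h2, h3, h4⟩ _ [] w.toList w'.toList le_rfl (StylAux.detect h)
end
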